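/- arXiv:2104.11346 — 6 statements merged into one kernel-verified Lean document; each statement's English description precedes it below -/
import Mathlib

section
/- Let κ > 0 and let f : ℝ → ℝ be a Schwartz function. Then ‖16κ⁴ R₀(2κ)f − 4κ² f − f''‖_{L²(ℝ)} ≤ (4κ²)⁻¹ ‖f''''‖_{L²(ℝ)}, where (R₀(2κ)g)(x) = ∫_ℝ (4κ)⁻¹ e^{−2κ|x−y|} g(y) dy. -/
open MeasureTheory

open Set Filter Topology ENNReal

/-- Young's inequality `L¹ * L² → L²` for nonnegative functions on the real line. -/
lemma lintegral_conv_rpow_two_le {k g : ℝ → ℝ≥0∞} (hk : Measurable k) (hg : Measurable g) :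
    ∫⁻ x, (∫⁻ t, k t * g (x - t)) ^ (2 : ℝ)
      ≤ (∫⁻ t, k t) ^ (2 : ℝ) * ∫⁻ x, g x ^ (2 : ℝ) := by
  have holder (x : ℝ) : (∫⁻ t, k t * g (x - t)) ^ (2 : ℝ)
      ≤ (∫⁻ t, k t) * ∫⁻ t, k t * g (x - t) ^ (2 : ℝ) := by
    have h := lintegral_mul_norm_pow_le (μ := volume) (f := k)
      (g := fun t => k t * g (x - t) ^ (2 : ℝ)) (p := 1 / 2) (q := 1 / 2)
      hk.aemeasurable (by fun_prop) (by norm_num) (by norm_num) (by norm_num)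
    have heq (t : ℝ) : k t ^ (1 / 2 : ℝ) * (k t * g (x - t) ^ (2 : ℝ)) ^ (1 / 2 : ℝ)
        = k t * g (x - t) := by
      rw [ENNReal.mul_rpow_of_nonneg _ _ (by norm_num), ← ENNReal.rpow_mul, ← mul_assoc,
        ← ENNReal.rpow_add_of_nonneg _ _ (by norm_num) (by norm_num)]
      norm_num
    simp_rw [heq] at h
    rw [← ENNReal.mul_rpow_of_nonneg _ _ (by norm_num)] at h
    refine (ENNReal.rpow_le_rpow h (by norm_num)).trans_eq ?_
    rw [← ENNReal.rpow_mul]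
    norm_num
  calc ∫⁻ x, (∫⁻ t, k t * g (x - t)) ^ (2 : ℝ)
      ≤ ∫⁻ x, (∫⁻ t, k t) * ∫⁻ t, k t * g (x - t) ^ (2 : ℝ) := lintegral_mono holder
    _ = (∫⁻ t, k t) * ∫⁻ t, ∫⁻ x, k t * g (x - t) ^ (2 : ℝ) := by
      rw [lintegral_const_mul _ (by fun_prop), lintegral_lintegral_swap (by fun_prop)]
    _ = (∫⁻ t, k t) * ∫⁻ t, k t * ∫⁻ x, g x ^ (2 : ℝ) := by
      congr 2 with t
      rw [lintegral_const_mul _ (by fun_prop),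
        lintegral_sub_right_eq_self (fun x => g x ^ (2 : ℝ)) t]
    _ = (∫⁻ t, k t) ^ (2 : ℝ) * ∫⁻ x, g x ^ (2 : ℝ) := by
      rw [lintegral_mul_const _ hk, ENNReal.rpow_two, pow_two, mul_assoc]

/-- Young's inequality `L¹ * L² → L²` for real functions on the real line. -/
lemma eLpNorm_integral_mul_comp_sub_le {k g : ℝ → ℝ} (hk : Measurable k) (hg : Measurable g) :
    eLpNorm (fun x => ∫ y, k (x - y) * g y) 2 volume
      ≤ (∫⁻ t, ‖k t‖ₑ) * eLpNorm g 2 volume := by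
  simp_rw [eLpNorm_eq_lintegral_rpow_enorm_toReal two_ne_zero ENNReal.ofNat_ne_top,
    ENNReal.toReal_ofNat]
  have bound (x : ℝ) : ‖∫ y, k (x - y) * g y‖ₑ ≤ ∫⁻ t, ‖k t‖ₑ * ‖g (x - t)‖ₑ := by
    refine (enorm_integral_le_lintegral_enorm _).trans_eq ?_
    rw [← lintegral_sub_left_eq_self _ x]
    simp [enorm_mul]
  calc (∫⁻ x, ‖∫ y, k (x - y) * g y‖ₑ ^ (2 : ℝ)) ^ (1 / 2 : ℝ)
      ≤ ((∫⁻ t, ‖k t‖ₑ) ^ (2 : ℝ) * ∫⁻ x, ‖g x‖ₑ ^ (2 : ℝ)) ^ (1 / 2 : ℝ) := by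
        refine ENNReal.rpow_le_rpow ?_ (by norm_num)
        exact (lintegral_mono fun x => ENNReal.rpow_le_rpow (bound x) (by norm_num)).trans
          (lintegral_conv_rpow_two_le hk.enorm hg.enorm)
    _ = _ := by
        rw [ENNReal.mul_rpow_of_nonneg _ _ (by norm_num), ← ENNReal.rpow_mul]
        norm_num

lemma integrable_exp_neg_mul_abs {a : ℝ} (ha : 0 < a) :
    Integrable fun t : ℝ => Real.exp (-(a * |t|)) := by
  have h : ∫ t : ℝ, Real.exp (-(a * |t|)) = 2 / a := by
    rw [integral_comp_abs (f := fun t => Real.exp (-(a * t)))]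
    have := integral_exp_mul_Ioi (neg_lt_zero.2 ha) 0
    simp only [neg_mul] at this
    rw [this]
    simp
    ring
  exact Integrable.of_integral_ne_zero (by rw [h]; positivity)

lemma lintegral_enorm_resolvent_kernel {a : ℝ} (ha : 0 < a) :
    ∫⁻ t : ℝ, ‖(2 * a)⁻¹ * Real.exp (-(a * |t|))‖ₑ = ENNReal.ofReal ((a ^ 2)⁻¹) := by
  rw [← ofReal_integral_norm_eq_lintegral_enorm ((integrable_exp_neg_mul_abs ha).const_mul _)]
  congr 1
  have h (t : ℝ) : ‖(2 * a)⁻¹ * Real.exp (-(a * |t|))‖ = (2 * a)⁻¹ * Real.exp (-(a * |t|)) :=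
    Real.norm_of_nonneg (by positivity)
  simp_rw [h]
  rw [integral_const_mul, integral_comp_abs (f := fun t => Real.exp (-(a * t)))]
  have := integral_exp_mul_Ioi (neg_lt_zero.2 ha) 0
  simp only [neg_mul] at this
  rw [this]
  simp
  field_simp

lemma SchwartzMap.integrable_exp_neg_mul_abs_mul {a : ℝ} (ha : 0 < a) (g : SchwartzMap ℝ ℝ)
    (x : ℝ) : Integrable fun t : ℝ => Real.exp (-(a * |t|)) * g (x - t) :=
  (integrable_exp_neg_mul_abs ha).mul_bdd
    (g.continuous.comp (continuous_const.sub continuous_id)).aestronglyMeasurable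
    (ae_of_all _ fun t => g.norm_le_seminorm ℝ (x - t))

/-- Integrals over the line, folded onto the positive half-line. -/
lemma integral_eq_integral_Ioi_add_comp_neg {u : ℝ → ℝ} (hu : Integrable u) :
    ∫ t, u t = ∫ t in Ioi (0 : ℝ), (u t + u (-t)) := by
  rw [integral_add hu.integrableOn hu.comp_neg.integrableOn, integral_comp_neg_Ioi, neg_zero,
    add_comm, ← setIntegral_union (Iic_disjoint_Ioi le_rfl) measurableSet_Ioi
      hu.integrableOn hu.integrableOn, Iic_union_Ioi, setIntegral_univ]

/-- Green's identity for the kernel `exp (-a |t|)`: it is `2a` times the fundamental solution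
of `-∂² + a²`. -/
lemma SchwartzMap.integral_exp_neg_mul_abs_mul_deriv_deriv {a : ℝ} (ha : 0 < a)
    (g : SchwartzMap ℝ ℝ) (x : ℝ) :
    ∫ t, Real.exp (-(a * |t|)) * deriv (deriv g) (x - t)
      = a ^ 2 * (∫ t, Real.exp (-(a * |t|)) * g (x - t)) - 2 * a * g x := by
  set g₁ := SchwartzMap.derivCLM ℝ ℝ g
  set g₂ := SchwartzMap.derivCLM ℝ ℝ g₁
  have d₀ (y : ℝ) : HasDerivAt g (g₁ y) y := g.hasDerivAt y
  have d₁ (y : ℝ) : HasDerivAt g₁ (g₂ y) y := g₁.hasDerivAt y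
  change ∫ t, Real.exp (-(a * |t|)) * g₂ (x - t) = _
  have i₀ := SchwartzMap.integrable_exp_neg_mul_abs_mul ha g x
  have i₂ := SchwartzMap.integrable_exp_neg_mul_abs_mul ha g₂ x
  have hI : Integrable fun t => Real.exp (-(a * |t|)) * g₂ (x - t)
      - a ^ 2 * (Real.exp (-(a * |t|)) * g (x - t)) := i₂.sub (i₀.const_mul (a ^ 2))
  suffices h : ∫ t, (Real.exp (-(a * |t|)) * g₂ (x - t)
      - a ^ 2 * (Real.exp (-(a * |t|)) * g (x - t))) = -(2 * a * g x) by
    rw [integral_sub i₂ (i₀.const_mul _), integral_const_mul] at h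
    linarith
  rw [integral_eq_integral_Ioi_add_comp_neg hI]
  let F (t : ℝ) : ℝ := Real.exp (-(a * t)) *
    (g₁ (x + t) - g₁ (x - t) + a * (g (x + t) + g (x - t)))
  let F' (t : ℝ) : ℝ := Real.exp (-(a * t)) *
    (g₂ (x + t) + g₂ (x - t) - a ^ 2 * (g (x + t) + g (x - t)))
  have hF (t : ℝ) : HasDerivAt F (F' t) t := by
    have he : HasDerivAt (fun t => Real.exp (-(a * t))) (Real.exp (-(a * t)) * -(a * 1)) t :=
      ((hasDerivAt_id t).const_mul a).neg.exp
    have hp : HasDerivAt (fun t => g (x + t)) (g₁ (x + t)) t := (d₀ (x + t)).comp_const_add x t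
    have hm : HasDerivAt (fun t => g (x - t)) (-g₁ (x - t)) t := (d₀ (x - t)).comp_const_sub x t
    have hp₁ : HasDerivAt (fun t => g₁ (x + t)) (g₂ (x + t)) t :=
      (d₁ (x + t)).comp_const_add x t
    have hm₁ : HasDerivAt (fun t => g₁ (x - t)) (-g₂ (x - t)) t :=
      (d₁ (x - t)).comp_const_sub x t
    refine (he.mul ((hp₁.sub hm₁).add ((hp.add hm).const_mul a))).congr_deriv ?_
    simp only [F', Pi.add_apply, Pi.sub_apply]
    ring
  have hlim : Tendsto F atTop (𝓝 0) := by
    have he : Tendsto (fun t => Real.exp (-(a * t))) atTop (𝓝 0) :=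
      Real.tendsto_exp_neg_atTop_nhds_zero.comp (tendsto_id.const_mul_atTop ha)
    refine he.zero_mul_isBoundedUnder_le (isBoundedUnder_of
      ⟨2 * SchwartzMap.seminorm ℝ 0 0 g₁ + a * (2 * SchwartzMap.seminorm ℝ 0 0 g), fun t => ?_⟩)
    have b₁ := g₁.norm_le_seminorm ℝ (x + t)
    have b₂ := g₁.norm_le_seminorm ℝ (x - t)
    have b₃ := g.norm_le_seminorm ℝ (x + t)
    have b₄ := g.norm_le_seminorm ℝ (x - t)
    calc ‖g₁ (x + t) - g₁ (x - t) + a * (g (x + t) + g (x - t))‖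
        ≤ ‖g₁ (x + t)‖ + ‖g₁ (x - t)‖ + a * (‖g (x + t)‖ + ‖g (x - t)‖) := by
          refine (norm_add_le _ _).trans (add_le_add (norm_sub_le _ _) ?_)
          rw [norm_mul, Real.norm_of_nonneg ha.le]
          gcongr
          exact norm_add_le _ _
      _ ≤ _ := by
          refine add_le_add (by linarith) (mul_le_mul_of_nonneg_left (by linarith) ha.le)
  have hcongr : EqOn F' (fun t => (Real.exp (-(a * |t|)) * g₂ (x - t)
      - a ^ 2 * (Real.exp (-(a * |t|)) * g (x - t)))
      + (Real.exp (-(a * |-t|)) * g₂ (x - -t)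
      - a ^ 2 * (Real.exp (-(a * |-t|)) * g (x - -t)))) (Ioi 0) := by
    intro t ht
    simp only [F', abs_neg, abs_of_pos (mem_Ioi.1 ht), sub_neg_eq_add]
    ring
  have hFint : IntegrableOn F' (Ioi 0) :=
    (hI.add hI.comp_neg).integrableOn.congr_fun hcongr.symm measurableSet_Ioi
  have key := integral_Ioi_of_hasDerivAt_of_tendsto' (fun t _ => hF t) hFint hlim
  rw [setIntegral_congr_fun measurableSet_Ioi hcongr] at key
  refine key.trans ?_
  simp only [F, mul_zero, neg_zero, Real.exp_zero, add_zero, sub_zero]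
  ring

/-- `R₀(a) g'' = a² R₀(a) g - g`. -/
lemma SchwartzMap.resolvent_deriv_deriv {a : ℝ} (ha : 0 < a) (g : SchwartzMap ℝ ℝ) (x : ℝ) :
    ∫ y, (2 * a)⁻¹ * Real.exp (-(a * |x - y|)) * deriv (deriv g) y
      = a ^ 2 * (∫ y, (2 * a)⁻¹ * Real.exp (-(a * |x - y|)) * g y) - g x := by
  have hsub (h : ℝ → ℝ) : ∫ y, (2 * a)⁻¹ * Real.exp (-(a * |x - y|)) * h y
      = (2 * a)⁻¹ * ∫ t, Real.exp (-(a * |t|)) * h (x - t) := by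
    rw [← integral_sub_left_eq_self _ volume x, ← integral_const_mul]
    simp [mul_assoc]
  rw [hsub, hsub, SchwartzMap.integral_exp_neg_mul_abs_mul_deriv_deriv ha]
  field_simp

/-- Quantitative convergence of the linear part of the `H_κ` flow generator to `∂²`:
`‖16κ⁴ R₀(2κ)f − 4κ²f − f''‖_{L²} ≤ (4κ²)⁻¹ ‖f''''‖_{L²}` for Schwartz `f`. -/
theorem linear_part_L2_bound (κ : ℝ) (hκ : 0 < κ) (f : SchwartzMap ℝ ℝ) :
    eLpNorm (fun x : ℝ =>
        16 * κ ^ 4 * (∫ y : ℝ, (4 * κ)⁻¹ * Real.exp (-(2 * κ * |x - y|)) * f y)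
          - 4 * κ ^ 2 * f x - iteratedDeriv 2 (f : ℝ → ℝ) x) 2 volume
      ≤ ENNReal.ofReal ((4 * κ ^ 2)⁻¹) *
          eLpNorm (iteratedDeriv 4 (f : ℝ → ℝ)) 2 volume := by
  have ha : 0 < 2 * κ := by positivity
  let f₂ := SchwartzMap.derivCLM ℝ ℝ (SchwartzMap.derivCLM ℝ ℝ f)
  have h₂ : iteratedDeriv 2 (f : ℝ → ℝ) = f₂ := by
    simp only [iteratedDeriv_succ, iteratedDeriv_zero]; rfl
  have h₄ : iteratedDeriv 4 (f : ℝ → ℝ) = deriv (deriv f₂) := by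
    simp only [iteratedDeriv_succ, iteratedDeriv_zero]; rfl
  have hconst : (2 * (2 * κ))⁻¹ = (4 * κ)⁻¹ := by ring_nf
  have hid (x : ℝ) : 16 * κ ^ 4 * (∫ y : ℝ, (4 * κ)⁻¹ * Real.exp (-(2 * κ * |x - y|)) * f y)
      - 4 * κ ^ 2 * f x - f₂ x
      = ∫ y, (2 * (2 * κ))⁻¹ * Real.exp (-(2 * κ * |x - y|)) * deriv (deriv f₂) y := by
    have e₁ : ∫ y, (2 * (2 * κ))⁻¹ * Real.exp (-(2 * κ * |x - y|)) * f₂ y = _ :=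
      f.resolvent_deriv_deriv ha x
    rw [f₂.resolvent_deriv_deriv ha x, e₁, hconst]
    ring
  simp_rw [h₂, h₄, hid]
  have hY := eLpNorm_integral_mul_comp_sub_le
    (k := fun t => (2 * (2 * κ))⁻¹ * Real.exp (-(2 * κ * |t|))) (g := deriv (deriv f₂))
    (by fun_prop) (measurable_deriv _)
  rw [lintegral_enorm_resolvent_kernel ha] at hY
  convert hY using 4
  ring
end

section
/- Let κ > 0 and let f, h : ℝ → ℝ be Schwartz functions. Write R = R₀(2κ), i.e. (Rg)(x) = ∫_ℝ (4κ)⁻¹ e^{−2κ|x−y|} g(y) dy. Then for every x ∈ ℝ: 16κ⁵ T_κ(f,h)(x) = 3 f(x)h(x) − 3 (Rf'')(x)(Rh'')(x) − 20κ² (Rf')(x)(Rh')(x) + 4κ² (R[((Rf')(Rh'))''])(x) + 20κ² ((Rf)(Rh))''(x) + 8κ² (R[((Rf)(Rh))''''])(x). -/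
open MeasureTheory

/-- Free resolvent kernel `G₀(x,y) = (2κ)⁻¹ e^{-κ|x-y|}`. -/
noncomputable def freeKernel (κ a b : ℝ) : ℝ := (2 * κ)⁻¹ * Real.exp (-(κ * |a - b|))

/-- The resolvent `R₀(2κ)` acting on a function:
`(R₀(2κ)g)(a) = ∫ (4κ)⁻¹ e^{-2κ|a-y|} g(y) dy`. -/
noncomputable def resolvent2κ (κ : ℝ) (g : ℝ → ℝ) (a : ℝ) : ℝ :=
  ∫ y : ℝ, (4 * κ)⁻¹ * Real.exp (-(2 * κ * |a - y|)) * g y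

/-- The kernel expression `T_κ(f,h)(x) = ⟨δ_x, R₀(κ) f R₀(κ) h R₀(κ) δ_x⟩`. -/
noncomputable def quadKernel (κ : ℝ) (f h : ℝ → ℝ) (x : ℝ) : ℝ :=
  ∫ y : ℝ, ∫ z : ℝ, freeKernel κ x y * f y * freeKernel κ y z * h z * freeKernel κ z x

open Set Filter Topology

/-- A continuous bounded function on the line. -/
def BddCont (g : ℝ → ℝ) : Prop := Continuous g ∧ ∃ C, ∀ x, |g x| ≤ C

namespace BddCont

variable {f g : ℝ → ℝ}

lemma add (hf : BddCont f) (hg : BddCont g) : BddCont fun x => f x + g x := by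
  obtain ⟨hf, C, hC⟩ := hf
  obtain ⟨hg, D, hD⟩ := hg
  exact ⟨hf.add hg, C + D, fun x => (abs_add_le _ _).trans (add_le_add (hC x) (hD x))⟩

lemma mul (hf : BddCont f) (hg : BddCont g) : BddCont fun x => f x * g x := by
  obtain ⟨hf, C, hC⟩ := hf
  obtain ⟨hg, D, hD⟩ := hg
  refine ⟨hf.mul hg, C * D, fun x => ?_⟩
  rw [abs_mul]
  exact mul_le_mul (hC x) (hD x) (abs_nonneg _) ((abs_nonneg _).trans (hC x))

lemma const_mul (c : ℝ) (hf : BddCont f) : BddCont fun x => c * f x :=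
  mul ⟨continuous_const, |c|, fun _ => le_rfl⟩ hf

lemma sub (hf : BddCont f) (hg : BddCont g) : BddCont fun x => f x - g x := by
  simpa [sub_eq_add_neg] using hf.add (hg.const_mul (-1))

lemma comp_neg (hf : BddCont f) : BddCont fun x => f (-x) :=
  ⟨hf.1.comp continuous_neg, hf.2.imp fun _ hC x => hC (-x)⟩

end BddCont

/-- The left half `∫_{y ≤ x} e^{-m(x-y)} g(y) dy` of convolution with `e^{-m|·|}`. -/
noncomputable def expLeft (m : ℝ) (g : ℝ → ℝ) (x : ℝ) : ℝ :=
  ∫ y in Iic x, Real.exp (-(m * (x - y))) * g y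

/-- The right half `∫_{y > x} e^{-m(y-x)} g(y) dy` of convolution with `e^{-m|·|}`. -/
noncomputable def expRight (m : ℝ) (g : ℝ → ℝ) (x : ℝ) : ℝ :=
  expLeft m (fun y => g (-y)) (-x)

section

variable {m : ℝ} {f g : ℝ → ℝ}

lemma integrableOn_exp_neg_mul_sub (hm : 0 < m) (x b : ℝ) :
    IntegrableOn (fun y => Real.exp (-(m * (x - y)))) (Iic b) := by
  have := (integrableOn_exp_mul_Iic hm b).const_mul (Real.exp (-(m * x)))
  refine this.congr (Eventually.of_forall fun y => ?_)
  simp only [← Real.exp_add]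
  ring_nf

lemma integral_exp_neg_mul_sub (hm : 0 < m) (x : ℝ) :
    ∫ y in Iic x, Real.exp (-(m * (x - y))) = m⁻¹ := by
  have : ∀ y, Real.exp (-(m * (x - y))) = Real.exp (-(m * x)) * Real.exp (m * y) := fun y => by
    rw [← Real.exp_add]; ring_nf
  simp_rw [this]
  rw [integral_const_mul, integral_exp_mul_Iic hm, mul_div_assoc', ← Real.exp_add]
  simp

lemma BddCont.integrableOn_exp_mul (hm : 0 < m) (hg : BddCont g) (x b : ℝ) :
    IntegrableOn (fun y => Real.exp (-(m * (x - y))) * g y) (Iic b) := by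
  obtain ⟨hg, C, hC⟩ := hg
  exact (integrableOn_exp_neg_mul_sub hm x b).mul_bdd (c := C) hg.aestronglyMeasurable
    (Eventually.of_forall hC)

lemma expLeft_add (hm : 0 < m) (hf : BddCont f) (hg : BddCont g) (x : ℝ) :
    expLeft m (fun y => f y + g y) x = expLeft m f x + expLeft m g x := by
  simp only [expLeft, mul_add]
  exact integral_add (hf.integrableOn_exp_mul hm x x) (hg.integrableOn_exp_mul hm x x)

lemma expLeft_const_mul (c x : ℝ) :
    expLeft m (fun y => c * g y) x = c * expLeft m g x := by
  simp only [expLeft, mul_left_comm _ c]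
  exact integral_const_mul _ _

lemma expRight_add (hm : 0 < m) (hf : BddCont f) (hg : BddCont g) (x : ℝ) :
    expRight m (fun y => f y + g y) x = expRight m f x + expRight m g x :=
  expLeft_add hm hf.comp_neg hg.comp_neg _

lemma expRight_const_mul (c x : ℝ) :
    expRight m (fun y => c * g y) x = c * expRight m g x :=
  expLeft_const_mul _ _

lemma abs_expLeft_le (hm : 0 < m) {C : ℝ} (hC : ∀ x, |g x| ≤ C) (x : ℝ) :
    |expLeft m g x| ≤ C * m⁻¹ := by
  rw [← integral_exp_neg_mul_sub hm x, ← integral_const_mul, ← Real.norm_eq_abs, expLeft]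
  refine norm_integral_le_of_norm_le ((integrableOn_exp_neg_mul_sub hm x x).const_mul C)
    (Eventually.of_forall fun y => ?_)
  rw [norm_mul, Real.norm_eq_abs, Real.abs_exp, mul_comm]
  exact mul_le_mul_of_nonneg_right (hC y) (Real.exp_nonneg _)

lemma hasDerivAt_expLeft (hm : 0 < m) (hg : BddCont g) (x : ℝ) :
    HasDerivAt (expLeft m g) (g x - m * expLeft m g x) x := by
  have hc : Continuous fun y => Real.exp (-(m * (0 - y))) * g y := by
    have := hg.1; fun_prop
  have key : expLeft m g = fun x => Real.exp (-(m * x)) *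
      ((∫ y in Iic 0, Real.exp (-(m * (0 - y))) * g y) +
        ∫ y in (0 : ℝ)..x, Real.exp (-(m * (0 - y))) * g y) := by
    ext x
    rw [← intervalIntegral.integral_Iic_sub_Iic (hg.integrableOn_exp_mul hm 0 0)
      (hg.integrableOn_exp_mul hm 0 x), add_sub_cancel, ← integral_const_mul, expLeft]
    congr 1 with y
    rw [← mul_assoc, ← Real.exp_add]
    ring_nf
  have h1 : HasDerivAt (fun x => Real.exp (-(m * x))) (Real.exp (-(m * x)) * -(m * 1)) x :=
    ((hasDerivAt_id x).const_mul m).neg.exp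
  have h2 := h1.mul ((hc.integral_hasStrictDerivAt 0 x).hasDerivAt.const_add
    (∫ y in Iic 0, Real.exp (-(m * (0 - y))) * g y))
  rw [key]
  refine h2.congr_deriv ?_
  have h3 : Real.exp (-(m * x)) * Real.exp (-(m * (0 - x))) = 1 := by
    rw [← Real.exp_add]; simp
  linear_combination g x * h3

lemma BddCont.expLeft (hm : 0 < m) (hg : BddCont g) : BddCont (expLeft m g) := by
  refine ⟨continuous_iff_continuousAt.2 fun x => (hasDerivAt_expLeft hm hg x).continuousAt, ?_⟩
  obtain ⟨-, C, hC⟩ := hg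
  exact ⟨_, abs_expLeft_le hm hC⟩

lemma BddCont.expRight (hm : 0 < m) (hg : BddCont g) : BddCont (expRight m g) :=
  (hg.comp_neg.expLeft hm).comp_neg

lemma hasDerivAt_expRight (hm : 0 < m) (hg : BddCont g) (x : ℝ) :
    HasDerivAt (expRight m g) (m * expRight m g x - g x) x := by
  have := (hasDerivAt_expLeft hm hg.comp_neg (-x)).scomp x (hasDerivAt_neg x)
  refine this.congr_deriv ?_
  simp [_root_.expRight]

/-- Integration by parts for `expLeft`. -/
lemma expLeft_of_hasDerivAt (hm : 0 < m) {g' : ℝ → ℝ} (hg : BddCont g) (hg' : BddCont g')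
    (h : ∀ x, HasDerivAt g (g' x) x) (x : ℝ) :
    expLeft m g' x = g x - m * expLeft m g x := by
  have hd : ∀ y ∈ Iic x, HasDerivAt (fun y => Real.exp (-(m * (x - y))) * g y)
      (Real.exp (-(m * (x - y))) * (m * g y + g' y)) y := fun y _ => by
    have h1 : HasDerivAt (fun y => Real.exp (-(m * (x - y))))
        (Real.exp (-(m * (x - y))) * -(m * (-1))) y :=
      (((hasDerivAt_id y).const_sub x).const_mul m).neg.exp
    exact (h1.mul (h y)).congr_deriv (by ring)
  have hlim : Tendsto (fun y => Real.exp (-(m * (x - y))) * g y) atBot (𝓝 0) := by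
    obtain ⟨-, C, hC⟩ := hg
    refine Tendsto.zero_mul_isBoundedUnder_le ?_ (isBoundedUnder_of ⟨C, hC⟩)
    refine Real.tendsto_exp_atBot.comp ?_
    have : (fun y => -(m * (x - y))) = fun y => -(m * x) + m * y := by ext; ring
    rw [this]
    exact tendsto_atBot_add_const_left _ _ (tendsto_id.const_mul_atBot hm)
  have := integral_Iic_of_hasDerivAt_of_tendsto' hd
    (((hg.const_mul m).add hg').integrableOn_exp_mul hm x x) hlim
  change _root_.expLeft m (fun y => m * g y + g' y) x = _ at this
  rw [expLeft_add hm (hg.const_mul m) hg', expLeft_const_mul] at this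
  simp only [sub_self, mul_zero, neg_zero, Real.exp_zero, one_mul, sub_zero] at this
  linarith

/-- Integration by parts for `expRight`. -/
lemma expRight_of_hasDerivAt (hm : 0 < m) {g' : ℝ → ℝ} (hg : BddCont g) (hg' : BddCont g')
    (h : ∀ x, HasDerivAt g (g' x) x) (x : ℝ) :
    expRight m g' x = m * expRight m g x - g x := by
  have := expLeft_of_hasDerivAt hm hg.comp_neg (hg'.comp_neg.const_mul (-1))
    (fun y => ((h (-y)).scomp y (hasDerivAt_neg y)).congr_deriv (by simp)) (-x)
  rw [expLeft_const_mul, neg_neg] at this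
  simp only [expRight]
  linarith

lemma setIntegral_Ioi_exp_mul (x : ℝ) :
    ∫ y in Ioi x, Real.exp (-(m * (y - x))) * g y = expRight m g x := by
  have := integral_comp_neg_Iic (-x) fun y => Real.exp (-(m * (y - x))) * g y
  rw [neg_neg] at this
  rw [← this, expRight, expLeft]
  congr 1 with y
  ring_nf

lemma integrableOn_Ioi_comp_neg {F : ℝ → ℝ} {x : ℝ}
    (h : IntegrableOn (fun y => F (-y)) (Iic (-x))) : IntegrableOn F (Ioi x) := by
  rw [← integrableOn_Ici_iff_integrableOn_Ioi]
  have := ((Measure.measurePreserving_neg (volume : Measure ℝ)).integrableOn_comp_preimage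
    (Homeomorph.neg ℝ).measurableEmbedding (f := F) (s := Ici x)).1
  apply this
  simpa [Function.comp_def] using h

lemma resolvent2κ_eq {κ : ℝ} (hκ : 0 < κ) (hg : BddCont g) (x : ℝ) :
    resolvent2κ κ g x = (4 * κ)⁻¹ * (expLeft (2 * κ) g x + expRight (2 * κ) g x) := by
  have hm : 0 < 2 * κ := by positivity
  have e1 : EqOn (fun y => Real.exp (-(2 * κ * |x - y|)) * g y)
      (fun y => Real.exp (-(2 * κ * (x - y))) * g y) (Iic x) := fun y hy => by
    simp only [abs_of_nonneg (sub_nonneg.2 (mem_Iic.1 hy))]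
  have e2 : EqOn (fun y => Real.exp (-(2 * κ * |x - y|)) * g y)
      (fun y => Real.exp (-(2 * κ * (y - x))) * g y) (Ioi x) := fun y hy => by
    simp only [abs_sub_comm x y, abs_of_pos (sub_pos.2 (mem_Ioi.1 hy))]
  have i2 : IntegrableOn (fun y => Real.exp (-(2 * κ * (y - x))) * g y) (Ioi x) := by
    apply integrableOn_Ioi_comp_neg
    refine (hg.comp_neg.integrableOn_exp_mul hm (-x) (-x)).congr
      (Eventually.of_forall fun y => ?_)
    ring_nf
  simp only [resolvent2κ, mul_assoc (4 * κ)⁻¹]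
  rw [integral_const_mul, ← intervalIntegral.integral_Iic_add_Ioi (b := x)
    ((hg.integrableOn_exp_mul hm x x).congr_fun e1.symm measurableSet_Iic)
    (i2.congr_fun e2.symm measurableSet_Ioi),
    setIntegral_congr_fun measurableSet_Iic e1, setIntegral_congr_fun measurableSet_Ioi e2,
    setIntegral_Ioi_exp_mul]
  rfl

end

section

variable {m : ℝ} {f h : ℝ → ℝ}

/-- The contribution of `z ∈ ℝ` to the kernel integral when `y ≤ x`. -/
lemma integral_exp_triangle (hm : 0 < m) (hi : Integrable h) {x y : ℝ} (hy : y ≤ x) :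
    ∫ z, Real.exp (-(m / 2 * (|x - y| + |y - z| + |z - x|))) * h z =
      Real.exp (-(m * (x - y))) * (expLeft m h y + (∫ z in y..x, h z) + expRight m h x) := by
  have hker : Integrable fun z => Real.exp (-(m / 2 * (|x - y| + |y - z| + |z - x|))) * h z := by
    refine hi.bdd_mul (c := 1) (Continuous.aestronglyMeasurable (by fun_prop))
      (Eventually.of_forall fun z => ?_)
    rw [Real.norm_eq_abs, Real.abs_exp, Real.exp_le_one_iff]
    have : 0 ≤ m / 2 * (|x - y| + |y - z| + |z - x|) := by positivity
    linarith
  have e0 : |x - y| = x - y := abs_of_nonneg (sub_nonneg.2 hy)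
  have i1 : ∫ z in Iic y, Real.exp (-(m / 2 * (|x - y| + |y - z| + |z - x|))) * h z =
      Real.exp (-(m * (x - y))) * expLeft m h y := by
    rw [expLeft, ← integral_const_mul]
    refine setIntegral_congr_fun measurableSet_Iic fun z hz => ?_
    have hz : z ≤ y := hz
    rw [← mul_assoc, ← Real.exp_add, e0, abs_of_nonneg (sub_nonneg.2 hz),
      abs_of_nonpos (sub_nonpos.2 (hz.trans hy))]
    ring_nf
  have i2 : ∫ z in Ioc y x, Real.exp (-(m / 2 * (|x - y| + |y - z| + |z - x|))) * h z =
      Real.exp (-(m * (x - y))) * ∫ z in y..x, h z := by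
    rw [intervalIntegral.integral_of_le hy, ← integral_const_mul]
    refine setIntegral_congr_fun measurableSet_Ioc fun z hz => ?_
    rw [e0, abs_of_nonpos (sub_nonpos.2 hz.1.le), abs_of_nonpos (sub_nonpos.2 hz.2)]
    ring_nf
  have i3 : ∫ z in Ioi x, Real.exp (-(m / 2 * (|x - y| + |y - z| + |z - x|))) * h z =
      Real.exp (-(m * (x - y))) * expRight m h x := by
    rw [← setIntegral_Ioi_exp_mul, ← integral_const_mul]
    refine setIntegral_congr_fun measurableSet_Ioi fun z hz => ?_
    have hz : x < z := hz
    rw [← mul_assoc, ← Real.exp_add, e0, abs_of_nonpos (sub_nonpos.2 (hy.trans hz.le)),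
      abs_of_nonneg (sub_nonneg.2 hz.le)]
    ring_nf
  rw [← intervalIntegral.integral_Iic_add_Ioi (b := x) hker.integrableOn hker.integrableOn,
    ← Iic_union_Ioc_eq_Iic hy, setIntegral_union (Iic_disjoint_Ioc le_rfl) measurableSet_Ioc
      hker.integrableOn hker.integrableOn, i1, i2, i3]
  ring

lemma bddCont_integral (hh : BddCont h) (hi : Integrable h) (x : ℝ) :
    BddCont fun y => ∫ z in y..x, h z := by
  refine ⟨continuous_iff_continuousAt.2 fun y =>
    (intervalIntegral.integral_hasDerivAt_left (hh.1.intervalIntegrable _ _)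
      hh.1.aestronglyMeasurable.stronglyMeasurableAtFilter
      hh.1.continuousAt).continuousAt, ∫ z, |h z|, fun y => ?_⟩
  rw [← Real.norm_eq_abs]
  refine intervalIntegral.norm_integral_le_integral_norm_uIoc.trans ?_
  exact setIntegral_le_integral hi.norm (Eventually.of_forall fun z => norm_nonneg _)

lemma expLeft_mul_integral (hm : 0 < m) (hf : BddCont f) (hh : BddCont h) (hi : Integrable h)
    (x : ℝ) :
    expLeft m (fun y => f y * ∫ z in y..x, h z) x = expLeft m (fun y => h y * expLeft m f y) x := by
  have hΦ := bddCont_integral hh hi x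
  have hd : ∀ y, HasDerivAt (fun y => expLeft m f y * ∫ z in y..x, h z)
      (f y * (∫ z in y..x, h z) + ((-m) * (expLeft m f y * ∫ z in y..x, h z) +
        (-1) * (h y * expLeft m f y))) y := fun y => by
    have h1 := intervalIntegral.integral_hasDerivAt_left (hh.1.intervalIntegrable y x)
      hh.1.aestronglyMeasurable.stronglyMeasurableAtFilter hh.1.continuousAt
    exact ((hasDerivAt_expLeft hm hf y).mul h1).congr_deriv (by ring)
  have hP := hf.expLeft hm
  have key := expLeft_of_hasDerivAt hm (hP.mul hΦ) ((hf.mul hΦ).add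
    (((hP.mul hΦ).const_mul (-m)).add ((hh.mul hP).const_mul (-1)))) hd x
  rw [expLeft_add hm (hf.mul hΦ) (((hP.mul hΦ).const_mul (-m)).add ((hh.mul hP).const_mul (-1))),
    expLeft_add hm ((hP.mul hΦ).const_mul (-m)) ((hh.mul hP).const_mul (-1)), expLeft_const_mul,
    expLeft_const_mul, intervalIntegral.integral_same] at key
  linarith

lemma kernel_integral_Iic (hm : 0 < m) (hf : BddCont f) (hh : BddCont h) (hi : Integrable h)
    (x : ℝ) :
    IntegrableOn (fun y => f y *
      ∫ z, Real.exp (-(m / 2 * (|x - y| + |y - z| + |z - x|))) * h z) (Iic x) ∧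
    ∫ y in Iic x, f y * ∫ z, Real.exp (-(m / 2 * (|x - y| + |y - z| + |z - x|))) * h z =
      expLeft m (fun y => f y * expLeft m h y + h y * expLeft m f y) x +
        expLeft m f x * expRight m h x := by
  have hΦ := bddCont_integral hh hi x
  have hP := hf.expLeft hm
  have hPh := hh.expLeft hm
  have hG := (hf.mul hPh).add ((hf.mul hΦ).add (hf.const_mul (expRight m h x)))
  have e : EqOn (fun y => f y *
      ∫ z, Real.exp (-(m / 2 * (|x - y| + |y - z| + |z - x|))) * h z)
      (fun y => Real.exp (-(m * (x - y))) * (f y * expLeft m h y +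
        (f y * (∫ z in y..x, h z) + expRight m h x * f y))) (Iic x) := fun y hy => by
    simp only
    rw [integral_exp_triangle hm hi hy]
    ring
  refine ⟨(hG.integrableOn_exp_mul hm x x).congr_fun e.symm measurableSet_Iic, ?_⟩
  rw [setIntegral_congr_fun measurableSet_Iic e]
  change expLeft m (fun y => f y * expLeft m h y +
    (f y * (∫ z in y..x, h z) + expRight m h x * f y)) x = _
  rw [expLeft_add hm (hf.mul hPh) ((hf.mul hΦ).add (hf.const_mul _)),
    expLeft_add hm (hf.mul hΦ) (hf.const_mul _), expLeft_add hm (hf.mul hPh) (hh.mul hP),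
    expLeft_mul_integral hm hf hh hi, expLeft_const_mul]
  ring

lemma quadKernel_eq {κ : ℝ} (hκ : 0 < κ) (hf : BddCont f) (hh : BddCont h) (hi : Integrable h)
    (x : ℝ) :
    8 * κ ^ 3 * quadKernel κ f h x =
      expLeft (2 * κ) (fun y => f y * expLeft (2 * κ) h y + h y * expLeft (2 * κ) f y) x +
      expRight (2 * κ) (fun y => f y * expRight (2 * κ) h y + h y * expRight (2 * κ) f y) x +
      expLeft (2 * κ) f x * expRight (2 * κ) h x + expRight (2 * κ) f x * expLeft (2 * κ) h x := by
  have hm : 0 < 2 * κ := by positivity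
  obtain ⟨iL, eL⟩ := kernel_integral_Iic hm hf hh hi x
  obtain ⟨iR, eR⟩ := kernel_integral_Iic hm hf.comp_neg hh.comp_neg hi.comp_neg (-x)
  set F : ℝ → ℝ := fun y => f y *
    ∫ z, Real.exp (-(2 * κ / 2 * (|x - y| + |y - z| + |z - x|))) * h z with hF
  have hFneg : (fun y => f (-y) * ∫ z,
      Real.exp (-(2 * κ / 2 * (|-x - y| + |y - z| + |z - -x|))) * h (-z)) = fun y => F (-y) := by
    ext y
    simp only [hF]
    rw [← integral_neg_eq_self fun z =>
      Real.exp (-(2 * κ / 2 * (|x - -y| + |-y - z| + |z - x|))) * h z]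
    congr 2 with z
    rw [← abs_neg (-x - y), ← abs_neg (y - z), ← abs_neg (z - -x)]
    ring_nf
  rw [hFneg] at iR eR
  have hK : quadKernel κ f h x = (8 * κ ^ 3)⁻¹ * ∫ y, F y := by
    rw [quadKernel, ← integral_const_mul]
    congr 1 with y
    rw [hF]
    simp only
    rw [← mul_assoc, ← integral_const_mul]
    congr 1 with z
    have : Real.exp (-(2 * κ / 2 * (|x - y| + |y - z| + |z - x|))) =
        Real.exp (-(κ * |x - y|)) * Real.exp (-(κ * |y - z|)) * Real.exp (-(κ * |z - x|)) := by
      rw [← Real.exp_add, ← Real.exp_add]; ring_nf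
    rw [this]
    simp only [freeKernel]
    field_simp
    ring
  rw [hK, mul_inv_cancel_left₀ (by positivity),
    ← intervalIntegral.integral_Iic_add_Ioi iL (integrableOn_Ioi_comp_neg iR), eL]
  have := integral_comp_neg_Iic (-x) F
  rw [neg_neg] at this
  rw [← this, eR]
  simp only [expRight, neg_neg]
  ring

end

/-- Functions with continuous bounded derivatives up to order `n`. -/
def BddSmooth : ℕ → (ℝ → ℝ) → Prop
  | 0, g => BddCont g
  | n + 1, g => BddCont g ∧ ∃ g', BddSmooth n g' ∧ ∀ x, HasDerivAt g (g' x) x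

namespace BddSmooth

variable {n : ℕ} {m : ℝ} {f g : ℝ → ℝ}

lemma bddCont (hf : BddSmooth n f) : BddCont f := by
  cases n with
  | zero => exact hf
  | succ n => exact hf.1

lemma of_succ (hf : BddSmooth (n + 1) f) : BddSmooth n f := by
  induction n generalizing f with
  | zero => exact hf.1
  | succ n ih =>
    obtain ⟨hf, f', hf', hd⟩ := hf
    exact ⟨hf, f', ih hf', hd⟩

lemma add (hf : BddSmooth n f) (hg : BddSmooth n g) : BddSmooth n fun x => f x + g x := by
  induction n generalizing f g with
  | zero => exact BddCont.add hf hg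
  | succ n ih =>
    obtain ⟨hf, f', hf', hfd⟩ := hf
    obtain ⟨hg, g', hg', hgd⟩ := hg
    exact ⟨hf.add hg, _, ih hf' hg', fun x => (hfd x).add (hgd x)⟩

lemma const_mul (c : ℝ) (hf : BddSmooth n f) : BddSmooth n fun x => c * f x := by
  induction n generalizing f with
  | zero => exact BddCont.const_mul c hf
  | succ n ih =>
    obtain ⟨hf, f', hf', hfd⟩ := hf
    exact ⟨hf.const_mul c, _, ih hf', fun x => (hfd x).const_mul c⟩

lemma sub (hf : BddSmooth n f) (hg : BddSmooth n g) : BddSmooth n fun x => f x - g x := by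
  simpa [sub_eq_add_neg] using hf.add (hg.const_mul (-1))

lemma mul (hf : BddSmooth n f) (hg : BddSmooth n g) : BddSmooth n fun x => f x * g x := by
  induction n generalizing f g with
  | zero => exact BddCont.mul hf hg
  | succ n ih =>
    have hf₀ := hf.of_succ
    have hg₀ := hg.of_succ
    obtain ⟨hf, f', hf', hfd⟩ := hf
    obtain ⟨hg, g', hg', hgd⟩ := hg
    exact ⟨hf.mul hg, _, (ih hf' hg₀).add (ih hf₀ hg'), fun x => (hfd x).mul (hgd x)⟩

lemma expLeft (hm : 0 < m) (hg : BddSmooth n g) : BddSmooth (n + 1) (expLeft m g) := by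
  refine ⟨hg.bddCont.expLeft hm, _, ?_, hasDerivAt_expLeft hm hg.bddCont⟩
  induction n generalizing g with
  | zero => exact BddCont.sub hg ((BddCont.expLeft hm hg).const_mul m)
  | succ n ih =>
    have h : BddSmooth (n + 1) (_root_.expLeft m g) :=
      ⟨hg.bddCont.expLeft hm, _, ih hg.of_succ, hasDerivAt_expLeft hm hg.bddCont⟩
    exact hg.sub (h.const_mul m)

lemma expRight (hm : 0 < m) (hg : BddSmooth n g) : BddSmooth (n + 1) (expRight m g) := by
  refine ⟨hg.bddCont.expRight hm, _, ?_, hasDerivAt_expRight hm hg.bddCont⟩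
  induction n generalizing g with
  | zero => exact BddCont.sub ((BddCont.expRight hm hg).const_mul m) hg
  | succ n ih =>
    have h : BddSmooth (n + 1) (_root_.expRight m g) :=
      ⟨hg.bddCont.expRight hm, _, ih hg.of_succ, hasDerivAt_expRight hm hg.bddCont⟩
    exact (h.const_mul m).sub hg

lemma iteratedDeriv_two (hg : BddSmooth (n + 2) g) : BddSmooth n (iteratedDeriv 2 g) := by
  obtain ⟨-, g', ⟨-, g'', hg'', hd'⟩, hd⟩ := hg
  rw [iteratedDeriv_succ, iteratedDeriv_one, funext fun x => (hd x).deriv,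
    funext fun x => (hd' x).deriv]
  exact hg''

end BddSmooth

lemma SchwartzMap.bddSmooth (f : SchwartzMap ℝ ℝ) (n : ℕ) : BddSmooth n f := by
  have hf : BddCont f := ⟨f.continuous, _, fun x => by
    simpa using f.toBoundedContinuousFunction.norm_coe_le_norm x⟩
  induction n generalizing f with
  | zero => exact hf
  | succ n ih =>
    refine ⟨hf, _, ih (SchwartzMap.derivCLM ℝ ℝ f) ⟨SchwartzMap.continuous _, _, fun x => by
      simpa using! (SchwartzMap.derivCLM ℝ ℝ f).toBoundedContinuousFunction.norm_coe_le_norm x⟩,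
      f.hasDerivAt⟩

section

variable {κ : ℝ} {f g h : ℝ → ℝ}

lemma hasDerivAt_resolvent2κ (hκ : 0 < κ) (hg : BddCont g) (x : ℝ) :
    HasDerivAt (resolvent2κ κ g) ((expRight (2 * κ) g x - expLeft (2 * κ) g x) / 2) x := by
  have hm : 0 < 2 * κ := by positivity
  rw [funext (resolvent2κ_eq hκ hg)]
  refine (((hasDerivAt_expLeft hm hg x).add (hasDerivAt_expRight hm hg x)).const_mul
    (4 * κ)⁻¹).congr_deriv ?_
  field_simp
  ring

lemma resolvent2κ_of_hasDerivAt (hκ : 0 < κ) {g' : ℝ → ℝ} (hg : BddCont g) (hg' : BddCont g')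
    (h : ∀ x, HasDerivAt g (g' x) x) (x : ℝ) :
    resolvent2κ κ g' x = (expRight (2 * κ) g x - expLeft (2 * κ) g x) / 2 := by
  have hm : 0 < 2 * κ := by positivity
  rw [resolvent2κ_eq hκ hg', expLeft_of_hasDerivAt hm hg hg' h, expRight_of_hasDerivAt hm hg hg' h]
  field_simp
  ring

/-- `R₀(2κ) ∂² = 4κ² R₀(2κ) - 1`. -/
lemma resolvent2κ_iteratedDeriv_two (hκ : 0 < κ) (hg : BddSmooth 2 g) (x : ℝ) :
    resolvent2κ κ (iteratedDeriv 2 g) x = 4 * κ ^ 2 * resolvent2κ κ g x - g x := by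
  have hm : 0 < 2 * κ := by positivity
  obtain ⟨hg, g', ⟨hg', g'', hg'', hd'⟩, hd⟩ := hg
  rw [iteratedDeriv_succ, iteratedDeriv_one, funext fun x => (hd x).deriv,
    funext fun x => (hd' x).deriv, resolvent2κ_of_hasDerivAt hκ hg' hg'' hd',
    expLeft_of_hasDerivAt hm hg hg' hd, expRight_of_hasDerivAt hm hg hg' hd,
    resolvent2κ_eq hκ hg]
  field_simp
  ring

/-- The second derivative of a product of resolvents, through the one-sided integrals. -/
lemma iteratedDeriv_two_resolvent2κ_mul (hκ : 0 < κ) (hf : BddCont f) (hh : BddCont h) (x : ℝ) :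
    iteratedDeriv 2 (fun a => resolvent2κ κ f a * resolvent2κ κ h a) x =
      (4 * κ ^ 2 * resolvent2κ κ f x - f x) * resolvent2κ κ h x +
      2 * ((expRight (2 * κ) f x - expLeft (2 * κ) f x) / 2 *
        ((expRight (2 * κ) h x - expLeft (2 * κ) h x) / 2)) +
      resolvent2κ κ f x * (4 * κ ^ 2 * resolvent2κ κ h x - h x) := by
  have hm : 0 < 2 * κ := by positivity
  have h2 : ∀ {g : ℝ → ℝ}, BddCont g →
      HasDerivAt (fun x => (expRight (2 * κ) g x - expLeft (2 * κ) g x) / 2)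
        (4 * κ ^ 2 * resolvent2κ κ g x - g x) x := fun {g} hg => by
    refine (((hasDerivAt_expRight hm hg x).sub (hasDerivAt_expLeft hm hg x)).div_const
      2).congr_deriv ?_
    rw [resolvent2κ_eq hκ hg]
    field_simp
    ring
  have h1 := fun x => (hasDerivAt_resolvent2κ hκ hf x).mul (hasDerivAt_resolvent2κ hκ hh x)
  rw [iteratedDeriv_succ, iteratedDeriv_one]
  have e : deriv (fun a => resolvent2κ κ f a * resolvent2κ κ h a) = _ :=
    funext fun x => (h1 x).deriv
  rw [e]
  refine (((h2 hf).mul (hasDerivAt_resolvent2κ hκ hh x)).add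
    ((hasDerivAt_resolvent2κ hκ hf x).mul (h2 hh))).deriv.trans ?_
  ring

/-- The core identity `κ T = (Rf)(Rh) + R[(Rf)'(Rh)'] + 8κ² R[(Rf)(Rh)]`. -/
lemma mul_quadKernel (hκ : 0 < κ) (hf : BddCont f) (hh : BddCont h) (hi : Integrable h) (x : ℝ) :
    κ * quadKernel κ f h x = resolvent2κ κ f x * resolvent2κ κ h x +
      resolvent2κ κ (fun a => (expRight (2 * κ) f a - expLeft (2 * κ) f a) / 2 *
        ((expRight (2 * κ) h a - expLeft (2 * κ) h a) / 2)) x +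
      8 * κ ^ 2 * resolvent2κ κ (fun a => resolvent2κ κ f a * resolvent2κ κ h a) x := by
  have hm : 0 < 2 * κ := by positivity
  have hT := quadKernel_eq hκ hf hh hi x
  have hPf := hf.expLeft hm
  have hQf := hf.expRight hm
  have hPh := hh.expLeft hm
  have hQh := hh.expRight hm
  have dPf := hasDerivAt_expLeft hm hf
  have dQf := hasDerivAt_expRight hm hf
  have dPh := hasDerivAt_expLeft hm hh
  have dQh := hasDerivAt_expRight hm hh
  have ha := hPf.mul hPh
  have hb := hQf.mul hQh
  have hS := (hPf.mul hQh).add (hQf.mul hPh)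
  have hA := (hf.mul hPh).add (hh.mul hPf)
  have hB := (hf.mul hQh).add (hh.mul hQf)
  have kL := expLeft_of_hasDerivAt hm ha (hA.add (ha.const_mul (-(4 * κ))))
    (fun y => ((dPf y).mul (dPh y)).congr_deriv (by ring)) x
  have kR := expRight_of_hasDerivAt hm hb ((hB.const_mul (-1)).add (hb.const_mul (4 * κ)))
    (fun y => ((dQf y).mul (dQh y)).congr_deriv (by ring)) x
  have hsum := (ha.add hb).add hS
  have hdiff := (ha.const_mul (-(4 * κ))).add (hb.const_mul (4 * κ))
  have dsum := fun y => (((((dPf y).mul (dPh y)).add ((dQf y).mul (dQh y))).add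
    (((dPf y).mul (dQh y)).add ((dQf y).mul (dPh y)))).congr_deriv
      (g' := -(4 * κ) * (expLeft (2 * κ) f y * expLeft (2 * κ) h y) +
        4 * κ * (expRight (2 * κ) f y * expRight (2 * κ) h y)) (by ring))
  have sL := expLeft_of_hasDerivAt hm hsum hdiff dsum x
  have sR := expRight_of_hasDerivAt hm hsum hdiff dsum x
  rw [expLeft_add hm hA (ha.const_mul _), expLeft_const_mul] at kL
  rw [expRight_add hm (hB.const_mul _) (hb.const_mul _), expRight_const_mul,
    expRight_const_mul] at kR
  rw [expLeft_add hm (ha.const_mul _) (hb.const_mul _), expLeft_add hm (ha.add hb) hS,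
    expLeft_add hm ha hb, expLeft_const_mul, expLeft_const_mul] at sL
  rw [expRight_add hm (ha.const_mul _) (hb.const_mul _), expRight_add hm (ha.add hb) hS,
    expRight_add hm ha hb, expRight_const_mul, expRight_const_mul] at sR
  have e1 : (fun a => (expRight (2 * κ) f a - expLeft (2 * κ) f a) / 2 *
      ((expRight (2 * κ) h a - expLeft (2 * κ) h a) / 2)) = fun a =>
      (4 : ℝ)⁻¹ * ((expLeft (2 * κ) f a * expLeft (2 * κ) h a +
        expRight (2 * κ) f a * expRight (2 * κ) h a) +
        (-1) * (expLeft (2 * κ) f a * expRight (2 * κ) h a +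
          expRight (2 * κ) f a * expLeft (2 * κ) h a)) := by
    ext a; ring
  have e2 : (fun a => resolvent2κ κ f a * resolvent2κ κ h a) = fun a =>
      (16 * κ ^ 2)⁻¹ * ((expLeft (2 * κ) f a * expLeft (2 * κ) h a +
        expRight (2 * κ) f a * expRight (2 * κ) h a) +
        (expLeft (2 * κ) f a * expRight (2 * κ) h a +
          expRight (2 * κ) f a * expLeft (2 * κ) h a)) := by
    ext a
    rw [resolvent2κ_eq hκ hf, resolvent2κ_eq hκ hh]
    field_simp
    ring
  rw [e1, e2, resolvent2κ_eq hκ hf, resolvent2κ_eq hκ hh,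
    resolvent2κ_eq hκ (((ha.add hb).add (hS.const_mul _)).const_mul _),
    resolvent2κ_eq hκ (hsum.const_mul _), expLeft_const_mul, expLeft_const_mul,
    expRight_const_mul, expRight_const_mul, expLeft_add hm (ha.add hb) (hS.const_mul _),
    expRight_add hm (ha.add hb) (hS.const_mul _), expLeft_add hm (ha.add hb) hS,
    expRight_add hm (ha.add hb) hS, expLeft_add hm ha hb, expRight_add hm ha hb,
    expLeft_const_mul, expRight_const_mul]
  rw [← mul_right_inj' (show 8 * κ ^ 2 ≠ 0 by positivity)]
  have : 8 * κ ^ 2 * (κ * quadKernel κ f h x) = 8 * κ ^ 3 * quadKernel κ f h x := by ring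
  rw [this, hT]
  field_simp
  linear_combination 64 * (4 * kL - 4 * kR - sL + sR)

end

/-- Quadratic operator identity:
`16κ⁵ T_κ(f,h) = 3fh − 3(Rf'')(Rh'') − 20κ²(Rf')(Rh') + 4κ² R[((Rf')(Rh'))'']
  + 20κ² ((Rf)(Rh))'' + 8κ² R[((Rf)(Rh))'''']` with `R = R₀(2κ)`. -/
theorem quadratic_operator_identity (κ : ℝ) (hκ : 0 < κ) (f h : SchwartzMap ℝ ℝ) (x : ℝ) :
    16 * κ ^ 5 * quadKernel κ (f : ℝ → ℝ) (h : ℝ → ℝ) x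
      = 3 * f x * h x
        - 3 * resolvent2κ κ (iteratedDeriv 2 (f : ℝ → ℝ)) x
              * resolvent2κ κ (iteratedDeriv 2 (h : ℝ → ℝ)) x
        - 20 * κ ^ 2 * resolvent2κ κ (deriv (f : ℝ → ℝ)) x
              * resolvent2κ κ (deriv (h : ℝ → ℝ)) x
        + 4 * κ ^ 2 * resolvent2κ κ
            (iteratedDeriv 2 (fun a : ℝ =>
              resolvent2κ κ (deriv (f : ℝ → ℝ)) a * resolvent2κ κ (deriv (h : ℝ → ℝ)) a)) x
        + 20 * κ ^ 2 * iteratedDeriv 2 (fun a : ℝ =>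
              resolvent2κ κ (f : ℝ → ℝ) a * resolvent2κ κ (h : ℝ → ℝ) a) x
        + 8 * κ ^ 2 * resolvent2κ κ
            (iteratedDeriv 4 (fun a : ℝ =>
              resolvent2κ κ (f : ℝ → ℝ) a * resolvent2κ κ (h : ℝ → ℝ) a)) x := by
  have hf : BddSmooth 2 f := f.bddSmooth 2
  have hh : BddSmooth 2 h := h.bddSmooth 2
  have hm : 0 < 2 * κ := by positivity
  have hR : ∀ {n : ℕ} {g : ℝ → ℝ}, BddSmooth n g → BddSmooth (n + 1) (resolvent2κ κ g) := by
    intro n g hg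
    rw [funext (resolvent2κ_eq hκ hg.bddCont)]
    exact ((hg.expLeft hm).add (hg.expRight hm)).const_mul _
  have hu' : ∀ {g : ℝ → ℝ}, BddSmooth 2 g → resolvent2κ κ (deriv g) =
      fun a => (expRight (2 * κ) g a - expLeft (2 * κ) g a) / 2 := by
    rintro g ⟨hg, g', hg', hd⟩
    rw [funext fun x => (hd x).deriv]
    exact funext (resolvent2κ_of_hasDerivAt hκ hg hg'.bddCont hd)
  have hw : BddSmooth 2 fun a => (expRight (2 * κ) f a - expLeft (2 * κ) f a) / 2 *
      ((expRight (2 * κ) h a - expLeft (2 * κ) h a) / 2) := by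
    have := (((hf.expRight hm).sub (hf.expLeft hm)).mul
      ((hh.expRight hm).sub (hh.expLeft hm))).of_succ.const_mul 4⁻¹
    convert this using 2
    ring
  have huv : BddSmooth 4 fun a => resolvent2κ κ f a * resolvent2κ κ h a :=
    (hR (f.bddSmooth 3)).mul (hR (h.bddSmooth 3))
  have h4 : iteratedDeriv 4 (fun a => resolvent2κ κ f a * resolvent2κ κ h a) =
      iteratedDeriv 2 (iteratedDeriv 2 fun a => resolvent2κ κ f a * resolvent2κ κ h a) := by
    simp only [iteratedDeriv_succ, iteratedDeriv_zero]
  rw [h4, resolvent2κ_iteratedDeriv_two hκ huv.iteratedDeriv_two,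
    resolvent2κ_iteratedDeriv_two hκ huv.of_succ.of_succ,
    iteratedDeriv_two_resolvent2κ_mul hκ hf.bddCont hh.bddCont, hu' hf, hu' hh,
    resolvent2κ_iteratedDeriv_two hκ hw, resolvent2κ_iteratedDeriv_two hκ hf,
    resolvent2κ_iteratedDeriv_two hκ hh]
  linear_combination 16 * κ ^ 4 * mul_quadKernel hκ hf.bddCont hh.bddCont h.integrable x
end

section
/- There exists a constant C > 0 such that for every κ ≥ 1 and all real-valued Schwartz functions q, φ on ℝ: |∫_ℝ φ(x) · (16κ⁵ T_κ(q, q')(x) − 3 q(x) q'(x)) dx| ≤ C κ^{−2} ‖φ‖_{H¹} ‖q‖²_{H²}. -/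
open MeasureTheory

/-- `H¹` norm: `‖φ‖_{H¹} = (∫ φ² + φ'²)^{1/2}`. -/
noncomputable def H1norm (φ : ℝ → ℝ) : ℝ := Real.sqrt (∫ x : ℝ, φ x ^ 2 + deriv φ x ^ 2)

/-- `H²` norm: `‖q‖_{H²} = (∫ q² + q'² + q''²)^{1/2}`. -/
noncomputable def H2norm (q : ℝ → ℝ) : ℝ :=
  Real.sqrt (∫ x : ℝ, q x ^ 2 + deriv q x ^ 2 + iteratedDeriv 2 q x ^ 2)

theorem integral_abs_pow_mul_exp_neg (n : ℕ) {r : ℝ} (hr : 0 < r) :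
    ∫ x : ℝ, |x| ^ n * Real.exp (-(r * |x|)) = 2 * (n.factorial / r ^ (n + 1)) := by
  rw [integral_comp_abs (f := fun x : ℝ => x ^ n * Real.exp (-(r * x)))]
  have h := Real.integral_rpow_mul_exp_neg_mul_Ioi (a := (n : ℝ) + 1) (by positivity) hr
  rw [Real.Gamma_nat_eq_factorial] at h
  have e : (1 / r) ^ ((n : ℝ) + 1) = 1 / r ^ (n + 1) := by
    rw [show ((n : ℝ) + 1) = ((n + 1 : ℕ) : ℝ) by push_cast; rfl, Real.rpow_natCast, one_div_pow]
  rw [e] at h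
  simp only [add_sub_cancel_right, Real.rpow_natCast] at h
  rw [h]
  ring

theorem integrable_abs_pow_mul_exp_neg (n : ℕ) {r : ℝ} (hr : 0 < r) :
    Integrable (fun x : ℝ => |x| ^ n * Real.exp (-(r * |x|))) := by
  by_contra h
  have h0 := integral_abs_pow_mul_exp_neg n hr
  rw [integral_undef h] at h0
  have : 0 < 2 * ((n.factorial : ℝ) / r ^ (n + 1)) := by positivity
  linarith

/-- The exponential weight of the triangle with vertices `0`, `p.1`, `p.2`. -/
noncomputable def triangleWeight (κ : ℝ) (p : ℝ × ℝ) : ℝ :=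
  Real.exp (-(κ * (|p.1| + |p.2| + |p.1 - p.2|)))

theorem triangleWeight_pos (κ : ℝ) (p : ℝ × ℝ) : 0 < triangleWeight κ p := Real.exp_pos _

theorem continuous_triangleWeight (κ : ℝ) : Continuous (triangleWeight κ) := by
  unfold triangleWeight
  fun_prop

theorem triangleWeight_swap (κ : ℝ) (p : ℝ × ℝ) :
    triangleWeight κ p.swap = triangleWeight κ p := by
  simp only [triangleWeight, Prod.fst_swap, Prod.snd_swap, abs_sub_comm p.2 p.1, add_comm |p.2|]

theorem triangleWeight_neg (κ : ℝ) (p : ℝ × ℝ) :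
    triangleWeight κ (-p) = triangleWeight κ p := by
  simp only [triangleWeight, Prod.fst_neg, Prod.snd_neg, abs_neg, neg_sub_neg,
    abs_sub_comm p.2 p.1]

theorem triangleWeight_le {κ : ℝ} (hκ : 0 < κ) (p : ℝ × ℝ) :
    triangleWeight κ p ≤ Real.exp (-(κ * |p.1|)) * Real.exp (-(κ * |p.2|)) := by
  rw [triangleWeight, ← Real.exp_add, Real.exp_le_exp]
  nlinarith [mul_nonneg hκ.le (abs_nonneg (p.1 - p.2))]

theorem integrable_triangleWeight {κ : ℝ} (hκ : 0 < κ) : Integrable (triangleWeight κ) := by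
  have h := integrable_abs_pow_mul_exp_neg 0 hκ
  simp only [pow_zero, one_mul] at h
  refine (h.mul_prod h).mono' (continuous_triangleWeight κ).aestronglyMeasurable (.of_forall ?_)
  intro p
  rw [Real.norm_of_nonneg (triangleWeight_pos κ p).le]
  exact triangleWeight_le hκ p

theorem integrable_sq_mul_exp_mul_exp {κ : ℝ} (hκ : 0 < κ) :
    Integrable (fun p : ℝ × ℝ => (p.1 ^ 2 + p.2 ^ 2) *
      (Real.exp (-(κ * |p.1|)) * Real.exp (-(κ * |p.2|)))) ∧
    ∫ p : ℝ × ℝ, (p.1 ^ 2 + p.2 ^ 2) *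
      (Real.exp (-(κ * |p.1|)) * Real.exp (-(κ * |p.2|))) = 16 / κ ^ 4 := by
  have h0 := integrable_abs_pow_mul_exp_neg 0 hκ
  have h2 := integrable_abs_pow_mul_exp_neg 2 hκ
  have e : (fun p : ℝ × ℝ => (p.1 ^ 2 + p.2 ^ 2) *
      (Real.exp (-(κ * |p.1|)) * Real.exp (-(κ * |p.2|)))) = fun p =>
      (|p.1| ^ 2 * Real.exp (-(κ * |p.1|))) * (|p.2| ^ 0 * Real.exp (-(κ * |p.2|))) +
      (|p.1| ^ 0 * Real.exp (-(κ * |p.1|))) * (|p.2| ^ 2 * Real.exp (-(κ * |p.2|))) := by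
    funext p
    simp only [sq_abs, pow_zero, one_mul]
    ring
  have i1 := h2.mul_prod h0
  have i2 := h0.mul_prod h2
  rw [e]
  refine ⟨i1.add i2, ?_⟩
  rw [Measure.volume_eq_prod, integral_add i1 i2,
    integral_prod_mul (fun x : ℝ => |x| ^ 2 * Real.exp (-(κ * |x|)))
      (fun x : ℝ => |x| ^ 0 * Real.exp (-(κ * |x|))),
    integral_prod_mul (fun x : ℝ => |x| ^ 0 * Real.exp (-(κ * |x|)))
      (fun x : ℝ => |x| ^ 2 * Real.exp (-(κ * |x|)))]
  simp only [integral_abs_pow_mul_exp_neg _ hκ]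
  norm_num [Nat.factorial]
  field_simp
  norm_num

open Set in
theorem integral_triangleWeight_of_nonneg {κ : ℝ} (hκ : 0 < κ) {a : ℝ} (ha : 0 ≤ a)
    (hint : Integrable fun v : ℝ => triangleWeight κ (a, v)) :
    ∫ v : ℝ, triangleWeight κ (a, v) = Real.exp (-(2 * κ * a)) * (1 / κ + a) := by
  have h1 : ∫ v in Iic (0 : ℝ), triangleWeight κ (a, v) = Real.exp (-(2 * κ * a)) / (2 * κ) := by
    rw [setIntegral_congr_fun (g := fun v => Real.exp (-(2 * κ * a)) * Real.exp (2 * κ * v))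
      measurableSet_Iic, integral_const_mul, integral_exp_mul_Iic (by positivity)]
    · simp [div_eq_mul_inv]
    · intro v hv
      have hv : v ≤ 0 := hv
      simp only [triangleWeight]
      rw [abs_of_nonneg ha, abs_of_nonpos hv, abs_of_nonneg (by linarith), ← Real.exp_add]
      ring_nf
  have h2 : ∫ v in (0 : ℝ)..a, triangleWeight κ (a, v) = a * Real.exp (-(2 * κ * a)) := by
    rw [intervalIntegral.integral_congr (g := fun _ => Real.exp (-(2 * κ * a)))]
    · simp
    · intro v hv
      rw [uIcc_of_le ha] at hv
      simp only [triangleWeight]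
      rw [abs_of_nonneg ha, abs_of_nonneg hv.1, abs_of_nonneg (by linarith [hv.2])]
      ring_nf
  have h3 : ∫ v in Ioi a, triangleWeight κ (a, v) = Real.exp (-(2 * κ * a)) / (2 * κ) := by
    rw [setIntegral_congr_fun (g := fun v => Real.exp (-(2 * κ) * v)) measurableSet_Ioi,
      integral_exp_mul_Ioi (by linarith), neg_div_neg_eq, neg_mul]
    intro v hv
    have hv : a < v := hv
    simp only [triangleWeight]
    rw [abs_of_nonneg ha, abs_of_nonneg (by linarith), abs_of_nonpos (by linarith)]
    ring_nf
  rw [← intervalIntegral.integral_Iic_add_Ioi (b := 0) hint.integrableOn hint.integrableOn,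
    ← intervalIntegral.integral_interval_add_Ioi (b := a) hint.integrableOn hint.integrableOn,
    h1, h2, h3]
  field_simp
  ring

theorem integral_triangleWeight {κ : ℝ} (hκ : 0 < κ) :
    ∫ p : ℝ × ℝ, triangleWeight κ p = 3 / (2 * κ ^ 2) := by
  have hint (a : ℝ) : Integrable fun v : ℝ => triangleWeight κ (a, v) := by
    have h := (integrable_abs_pow_mul_exp_neg 0 hκ).const_mul (Real.exp (-(κ * |a|)))
    simp only [pow_zero, one_mul] at h
    refine h.mono' ((continuous_triangleWeight κ).comp
      (by fun_prop : Continuous fun v : ℝ => (a, v))).aestronglyMeasurable (.of_forall ?_)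
    intro v
    rw [Real.norm_of_nonneg (triangleWeight_pos κ _).le]
    exact triangleWeight_le hκ _
  have inner (a : ℝ) : ∫ v : ℝ, triangleWeight κ (a, v) =
      1 / κ * (|a| ^ 0 * Real.exp (-(2 * κ * |a|))) + |a| ^ 1 * Real.exp (-(2 * κ * |a|)) := by
    have key : ∫ v : ℝ, triangleWeight κ (a, v) = Real.exp (-(2 * κ * |a|)) * (1 / κ + |a|) := by
      rcases le_total 0 a with ha | ha
      · rw [abs_of_nonneg ha, integral_triangleWeight_of_nonneg hκ ha (hint a)]
      · rw [abs_of_nonpos ha, ← integral_triangleWeight_of_nonneg hκ (neg_nonneg.2 ha) (hint _),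
          ← integral_neg_eq_self]
        congr 1
        funext v
        simpa using (triangleWeight_neg κ (a, -v)).symm
    rw [key]
    ring
  have h2κ : 0 < 2 * κ := by positivity
  rw [Measure.volume_eq_prod, integral_prod _ (integrable_triangleWeight hκ)]
  simp only [inner]
  rw [integral_add ((integrable_abs_pow_mul_exp_neg 0 h2κ).const_mul _)
    (integrable_abs_pow_mul_exp_neg 1 h2κ), integral_const_mul,
    integral_abs_pow_mul_exp_neg _ h2κ, integral_abs_pow_mul_exp_neg _ h2κ]
  norm_num [Nat.factorial]
  field_simp
  norm_num

theorem sq_integral_mul_le {f g : ℝ → ℝ} (hf : Integrable fun x => f x ^ 2)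
    (hg : Integrable fun x => g x ^ 2) (hfg : Integrable fun x => f x * g x) :
    (∫ x, f x * g x) ^ 2 ≤ (∫ x, f x ^ 2) * ∫ x, g x ^ 2 := by
  have h (t : ℝ) : 0 ≤ (∫ x, g x ^ 2) * (t * t) + (2 * ∫ x, f x * g x) * t + ∫ x, f x ^ 2 := by
    have h0 : 0 ≤ ∫ x, (t ^ 2 * g x ^ 2 + 2 * t * (f x * g x) + f x ^ 2) :=
      integral_nonneg fun x => by
        simp only [Pi.zero_apply]
        nlinarith [sq_nonneg (t * g x + f x)]
    rw [integral_add ((hg.const_mul _).fun_add (hfg.const_mul _)) hf,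
      integral_add (hg.const_mul _) (hfg.const_mul _), integral_const_mul, integral_const_mul] at h0
    linarith
  have := discrim_le_zero h
  rw [discrim] at this
  nlinarith

namespace SchwartzMap

/-- The derivative of a Schwartz function on the line, as a Schwartz function. -/
noncomputable abbrev lineDeriv (f : SchwartzMap ℝ ℝ) : SchwartzMap ℝ ℝ := derivCLM ℝ ℝ f

theorem hasDerivAt_lineDeriv (f : SchwartzMap ℝ ℝ) (x : ℝ) : HasDerivAt f (f.lineDeriv x) x := by
  rw [derivCLM_apply]
  exact f.differentiableAt.hasDerivAt

theorem exists_forall_abs_le (f : SchwartzMap ℝ ℝ) : ∃ M, ∀ x, |f x| ≤ M :=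
  ⟨_, fun x => norm_le_seminorm ℝ f x⟩

theorem integrable_mul (f g : SchwartzMap ℝ ℝ) : Integrable fun x => f x * g x :=
  have ⟨_, hM⟩ := f.exists_forall_abs_le
  g.integrable.bdd_mul f.continuous.aestronglyMeasurable (.of_forall hM)

theorem integrable_sq (f : SchwartzMap ℝ ℝ) : Integrable fun x => f x ^ 2 := by
  simpa only [sq] using f.integrable_mul f

/-- The translated trilinear form `∫ ψ(x) f(x + u) g(x + v) dx`. -/
noncomputable def trilinear (ψ f g : SchwartzMap ℝ ℝ) (p : ℝ × ℝ) : ℝ :=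
  ∫ x, ψ x * (f (x + p.1) * g (x + p.2))

theorem integrable_trilinear (ψ f g : SchwartzMap ℝ ℝ) (a b : ℝ) :
    Integrable fun x => ψ x * (f (x + a) * g (x + b)) := by
  obtain ⟨M, hM⟩ := f.exists_forall_abs_le
  obtain ⟨N, hN⟩ := g.exists_forall_abs_le
  refine ψ.integrable.mul_bdd (c := M * N) (by fun_prop) (.of_forall fun x => ?_)
  rw [norm_mul]
  exact mul_le_mul (hM _) (hN _) (norm_nonneg _) ((abs_nonneg _).trans (hM x))

theorem trilinear_swap (ψ f g : SchwartzMap ℝ ℝ) (p : ℝ × ℝ) :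
    trilinear ψ f g p.swap = trilinear ψ g f p := by
  simp only [trilinear, Prod.fst_swap, Prod.snd_swap, mul_comm (f _)]

theorem abs_trilinear_le {ψ f g : SchwartzMap ℝ ℝ} {A B D : ℝ} (hA : 0 ≤ A) (hB : 0 ≤ B)
    (hD : 0 ≤ D) (hψ : ∫ x, ψ x ^ 2 ≤ A ^ 2) (hf : ∫ x, f x ^ 2 ≤ B ^ 2)
    (hg : ∀ x, |g x| ≤ D) (p : ℝ × ℝ) : |trilinear ψ f g p| ≤ A * (B * D) := by
  have hf' : Integrable fun x => f (x + p.1) ^ 2 := f.integrable_sq.comp_add_right p.1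
  have hg' (x : ℝ) : g (x + p.2) ^ 2 ≤ D ^ 2 := sq_le_sq.2 (by simpa [abs_of_nonneg hD] using hg _)
  have hle (x : ℝ) : (f (x + p.1) * g (x + p.2)) ^ 2 ≤ f (x + p.1) ^ 2 * D ^ 2 := by
    rw [mul_pow]
    exact mul_le_mul_of_nonneg_left (hg' x) (sq_nonneg _)
  have hi : Integrable fun x => (f (x + p.1) * g (x + p.2)) ^ 2 := by
    refine (hf'.mul_const (D ^ 2)).mono' (by fun_prop) (.of_forall fun x => ?_)
    rw [Real.norm_of_nonneg (sq_nonneg _)]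
    exact hle x
  have h1 : ∫ x, (f (x + p.1) * g (x + p.2)) ^ 2 ≤ B ^ 2 * D ^ 2 := by
    refine (integral_mono hi (hf'.mul_const _) hle).trans ?_
    rw [integral_mul_const, integral_add_right_eq_self (fun x => f x ^ 2)]
    exact mul_le_mul_of_nonneg_right hf (sq_nonneg _)
  refine abs_le_of_sq_le_sq ?_ (by positivity)
  calc trilinear ψ f g p ^ 2
      ≤ (∫ x, ψ x ^ 2) * ∫ x, (f (x + p.1) * g (x + p.2)) ^ 2 :=
        sq_integral_mul_le ψ.integrable_sq hi (integrable_trilinear ψ f g p.1 p.2)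
    _ ≤ A ^ 2 * (B ^ 2 * D ^ 2) :=
        mul_le_mul hψ h1 (integral_nonneg fun x => sq_nonneg _) (sq_nonneg _)
    _ = (A * (B * D)) ^ 2 := by ring

theorem hasDerivAt_trilinear (ψ f g : SchwartzMap ℝ ℝ) (u v t : ℝ) :
    HasDerivAt (fun s => trilinear ψ f g (s * u, s * v))
      (u * trilinear ψ f.lineDeriv g (t * u, t * v) +
        v * trilinear ψ f g.lineDeriv (t * u, t * v)) t := by
  obtain ⟨M, hM⟩ := f.exists_forall_abs_le
  obtain ⟨N, hN⟩ := g.exists_forall_abs_le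
  obtain ⟨M', hM'⟩ := f.lineDeriv.exists_forall_abs_le
  obtain ⟨N', hN'⟩ := g.lineDeriv.exists_forall_abs_le
  have key := (hasDerivAt_integral_of_dominated_loc_of_deriv_le (μ := volume)
    (F := fun s x => ψ x * (f (x + s * u) * g (x + s * v)))
    (F' := fun s x => u * (ψ x * (f.lineDeriv (x + s * u) * g (x + s * v))) +
      v * (ψ x * (f (x + s * u) * g.lineDeriv (x + s * v))))
    (bound := fun x => (|u| * (M' * N) + |v| * (M * N')) * |ψ x|) (x₀ := t) Filter.univ_mem
    (.of_forall fun s => (integrable_trilinear ψ f g _ _).aestronglyMeasurable)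
    (integrable_trilinear ψ f g _ _)
    (((integrable_trilinear ψ f.lineDeriv g _ _).const_mul u).add
      ((integrable_trilinear ψ f g.lineDeriv _ _).const_mul v)).aestronglyMeasurable
    (.of_forall fun x s _ => ?_) (ψ.integrable.abs.const_mul _)
    (.of_forall fun x s _ => ?_)).2
  · rw [integral_add ((integrable_trilinear ψ f.lineDeriv g _ _).const_mul u)
      ((integrable_trilinear ψ f g.lineDeriv _ _).const_mul v), integral_const_mul,
      integral_const_mul] at key
    exact key
  · have b1 : |f.lineDeriv (x + s * u)| * |g (x + s * v)| ≤ M' * N :=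
      mul_le_mul (hM' _) (hN _) (abs_nonneg _) ((abs_nonneg _).trans (hM' 0))
    have b2 : |f (x + s * u)| * |g.lineDeriv (x + s * v)| ≤ M * N' :=
      mul_le_mul (hM _) (hN' _) (abs_nonneg _) ((abs_nonneg _).trans (hM 0))
    refine (norm_add_le _ _).trans ?_
    simp only [Real.norm_eq_abs, abs_mul]
    calc _ = (|u| * (|f.lineDeriv (x + s * u)| * |g (x + s * v)|) +
          |v| * (|f (x + s * u)| * |g.lineDeriv (x + s * v)|)) * |ψ x| := by ring
      _ ≤ _ := by gcongr
  · have hf := (f.hasDerivAt_lineDeriv (x + s * u)).comp s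
      (((hasDerivAt_id s).mul_const u).const_add x)
    have hg := (g.hasDerivAt_lineDeriv (x + s * v)).comp s
      (((hasDerivAt_id s).mul_const v).const_add x)
    refine ((hf.mul hg).const_mul (ψ x)).congr_deriv ?_
    simp only [Function.comp_apply, id]
    ring

theorem trilinear_add_swap (φ q : SchwartzMap ℝ ℝ) (p : ℝ × ℝ) :
    trilinear φ q q.lineDeriv p + trilinear φ q q.lineDeriv p.swap =
      -trilinear φ.lineDeriv q q p := by
  rw [trilinear_swap]
  simp only [trilinear]
  have i1 := integrable_trilinear φ q q.lineDeriv p.1 p.2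
  have i2 := integrable_trilinear φ q.lineDeriv q p.1 p.2
  have hd (x : ℝ) : HasDerivAt (fun x => q (x + p.1) * q (x + p.2))
      (q.lineDeriv (x + p.1) * q (x + p.2) + q (x + p.1) * q.lineDeriv (x + p.2)) x :=
    ((q.hasDerivAt_lineDeriv _).comp_add_const x p.1).mul
      ((q.hasDerivAt_lineDeriv _).comp_add_const x p.2)
  rw [← integral_add i1 i2, ← integral_mul_deriv_eq_deriv_mul_of_integrable
    (fun x _ => φ.hasDerivAt_lineDeriv x) (fun x _ => hd x) ?_
    (integrable_trilinear φ.lineDeriv q q p.1 p.2) (integrable_trilinear φ q q p.1 p.2)]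
  · congr 1
    funext x
    ring
  · refine (i2.add i1).congr (.of_forall fun x => ?_)
    simp only [Pi.add_apply, Pi.mul_apply]
    ring

theorem sq_le_integral (f : SchwartzMap ℝ ℝ) (x : ℝ) :
    f x ^ 2 ≤ ∫ y, (f y ^ 2 + f.lineDeriv y ^ 2) := by
  have hd (y : ℝ) : HasDerivAt (fun y => f y ^ 2) (2 * (f y * f.lineDeriv y)) y := by
    refine ((f.hasDerivAt_lineDeriv y).pow 2).congr_deriv ?_
    push_cast
    ring
  have ht : Filter.Tendsto (fun y => f y ^ 2) Filter.atBot (nhds 0) := by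
    simpa using (f.tendsto_cocompact.mono_left atBot_le_cocompact).pow 2
  have hi : Integrable fun y => 2 * (f y * f.lineDeriv y) :=
    (f.integrable_mul f.lineDeriv).const_mul 2
  have hs : Integrable fun y => f y ^ 2 + f.lineDeriv y ^ 2 :=
    f.integrable_sq.add f.lineDeriv.integrable_sq
  have h := integral_Iic_of_hasDerivAt_of_tendsto' (a := x) (fun y _ => hd y) hi.integrableOn ht
  rw [sub_zero] at h
  rw [← h]
  refine (setIntegral_mono hi.integrableOn hs.integrableOn fun y => ?_).trans
    (setIntegral_le_integral hs (.of_forall fun y => ?_))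
  · nlinarith [sq_nonneg (f y - f.lineDeriv y)]
  · exact add_nonneg (sq_nonneg _) (sq_nonneg _)

end SchwartzMap

theorem abs_symm_second_difference_le {h h' h'' : ℝ → ℝ} {M : ℝ}
    (hh : ∀ t, HasDerivAt h (h' t) t) (hh' : ∀ t, HasDerivAt h' (h'' t) t)
    (hM : ∀ t, |h'' t| ≤ M) : |h 1 + h (-1) - 2 * h 0| ≤ 2 * M := by
  have hM0 : 0 ≤ M := (abs_nonneg _).trans (hM 0)
  have hk (t : ℝ) : HasDerivAt (fun s => h s + h (-s)) (h' t - h' (-t)) t := by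
    refine ((hh t).add ((hh (-t)).comp t (hasDerivAt_neg t))).congr_deriv ?_
    ring
  have hb : ∀ t ∈ Set.Ico (0 : ℝ) 1, ‖h' t - h' (-t)‖ ≤ 2 * M := by
    intro t ht
    refine (convex_univ.norm_image_sub_le_of_norm_hasDerivWithin_le
      (fun s _ => (hh' s).hasDerivWithinAt) (fun s _ => hM s) (Set.mem_univ (-t))
      (Set.mem_univ t)).trans ?_
    rw [sub_neg_eq_add, Real.norm_of_nonneg (by linarith [ht.1])]
    nlinarith [ht.2]
  have := norm_image_sub_le_of_norm_deriv_le_segment_01'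
    (fun t _ => (hk t).hasDerivWithinAt) hb
  rw [Real.norm_eq_abs] at this
  convert this using 2
  simp only [neg_zero]
  ring

namespace SchwartzMap

theorem abs_trilinear_second_difference_le {ψ q : SchwartzMap ℝ ℝ} {A B : ℝ} (hA : 0 ≤ A)
    (hB : 0 ≤ B) (hψ : ∫ x, ψ x ^ 2 ≤ A ^ 2) (hq' : ∫ x, q.lineDeriv x ^ 2 ≤ B ^ 2)
    (hq'' : ∫ x, q.lineDeriv.lineDeriv x ^ 2 ≤ B ^ 2) (hs : ∀ x, |q x| ≤ B)
    (hs' : ∀ x, |q.lineDeriv x| ≤ B) (p : ℝ × ℝ) :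
    |trilinear ψ q q p + trilinear ψ q q (-p) - 2 * trilinear ψ q q 0| ≤
      4 * (p.1 ^ 2 + p.2 ^ 2) * (A * B ^ 2) := by
  obtain ⟨u, v⟩ := p
  have h := abs_symm_second_difference_le (M := 2 * (u ^ 2 + v ^ 2) * (A * (B * B)))
    (fun t => hasDerivAt_trilinear ψ q q u v t)
    (fun t => ((hasDerivAt_trilinear ψ q.lineDeriv q u v t).const_mul u).add
      ((hasDerivAt_trilinear ψ q q.lineDeriv u v t).const_mul v)) (fun t => ?_)
  · simp only [one_mul, neg_mul, zero_mul] at h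
    refine h.trans (le_of_eq ?_)
    ring
  · have a1 := abs_trilinear_le hA hB hB hψ hq'' hs (t * u, t * v)
    have a2 := abs_trilinear_le hA hB hB hψ hq' hs' (t * u, t * v)
    have a3 := abs_trilinear_le hA hB hB hψ hq'' hs (t * u, t * v).swap
    rw [trilinear_swap] at a3
    refine (abs_add_le _ _).trans ?_
    have e1 := abs_add_le (u * trilinear ψ q.lineDeriv.lineDeriv q (t * u, t * v))
      (v * trilinear ψ q.lineDeriv q.lineDeriv (t * u, t * v))
    have e2 := abs_add_le (u * trilinear ψ q.lineDeriv q.lineDeriv (t * u, t * v))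
      (v * trilinear ψ q q.lineDeriv.lineDeriv (t * u, t * v))
    rw [abs_mul, abs_mul] at e1 e2 ⊢
    have hK : 0 ≤ A * (B * B) := by positivity
    set K := A * (B * B)
    have f1 := e1.trans (add_le_add (mul_le_mul_of_nonneg_left a1 (abs_nonneg u))
      (mul_le_mul_of_nonneg_left a2 (abs_nonneg v)))
    have f2 := e2.trans (add_le_add (mul_le_mul_of_nonneg_left a2 (abs_nonneg u))
      (mul_le_mul_of_nonneg_left a3 (abs_nonneg v)))
    refine (add_le_add (mul_le_mul_of_nonneg_left f1 (abs_nonneg u))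
      (mul_le_mul_of_nonneg_left f2 (abs_nonneg v))).trans ?_
    rw [← sq_abs u, ← sq_abs v]
    nlinarith [mul_nonneg hK (sq_nonneg (|u| - |v|))]

end SchwartzMap

open SchwartzMap

theorem integrable_weighted_trilinear {w : ℝ × ℝ → ℝ} (hw : Integrable w)
    (ψ f g : SchwartzMap ℝ ℝ) :
    Integrable (fun z : ℝ × (ℝ × ℝ) => ψ z.1 * w z.2 * (f (z.1 + z.2.1) * g (z.1 + z.2.2)))
      (volume.prod volume) := by
  obtain ⟨M, hM⟩ := f.exists_forall_abs_le
  obtain ⟨N, hN⟩ := g.exists_forall_abs_le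
  refine (ψ.integrable.mul_prod hw).mul_bdd (c := M * N)
    (Continuous.aestronglyMeasurable (by fun_prop)) (.of_forall fun z => ?_)
  rw [norm_mul]
  exact mul_le_mul (hM _) (hN _) (norm_nonneg _) ((abs_nonneg _).trans (hM 0))

theorem integrable_mul_trilinear {w : ℝ × ℝ → ℝ} (hw : Integrable w)
    (ψ f g : SchwartzMap ℝ ℝ) : Integrable fun p => w p * trilinear ψ f g p := by
  refine (integrable_weighted_trilinear hw ψ f g).integral_prod_right.congr (.of_forall fun p => ?_)
  simp only [trilinear, ← integral_const_mul]
  congr 1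
  funext x
  ring

theorem integrable_convolved_and_integral_eq {w : ℝ × ℝ → ℝ} (hw : Integrable w)
    (ψ f g : SchwartzMap ℝ ℝ) :
    Integrable (fun x => ψ x * ∫ p : ℝ × ℝ, w p * (f (x + p.1) * g (x + p.2))) ∧
    ∫ x, ψ x * ∫ p : ℝ × ℝ, w p * (f (x + p.1) * g (x + p.2)) =
      ∫ p, w p * trilinear ψ f g p := by
  have h := integrable_weighted_trilinear hw ψ f g
  constructor
  · refine h.integral_prod_left.congr (.of_forall fun x => ?_)
    simp only [mul_assoc, integral_const_mul]
  · have := integral_integral_swap (f := fun x p => ψ x * w p * (f (x + p.1) * g (x + p.2))) h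
    simp only [trilinear, ← integral_const_mul]
    simpa only [mul_assoc, mul_left_comm (w _) (ψ _)] using this

theorem quadKernel_eq_s6 {κ : ℝ} (hκ : 0 < κ) (f g : SchwartzMap ℝ ℝ) (x : ℝ) :
    quadKernel κ f g x = (2 * κ)⁻¹ ^ 3 *
      ∫ p : ℝ × ℝ, triangleWeight κ p * (f (x + p.1) * g (x + p.2)) := by
  obtain ⟨M, hM⟩ := f.exists_forall_abs_le
  obtain ⟨N, hN⟩ := g.exists_forall_abs_le
  have hint : Integrable fun p : ℝ × ℝ => triangleWeight κ p * (f (x + p.1) * g (x + p.2)) := by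
    refine (integrable_triangleWeight hκ).mul_bdd (c := M * N)
      (Continuous.aestronglyMeasurable (by fun_prop)) (.of_forall fun p => ?_)
    rw [norm_mul]
    exact mul_le_mul (hM _) (hN _) (norm_nonneg _) ((abs_nonneg _).trans (hM 0))
  rw [Measure.volume_eq_prod, integral_prod _ hint, ← integral_const_mul, quadKernel,
    ← integral_add_left_eq_self _ x]
  congr 1
  funext u
  rw [← integral_const_mul, ← integral_add_left_eq_self _ x]
  congr 1
  funext v
  have e : Real.exp (-(κ * |u|)) * Real.exp (-(κ * |u - v|)) * Real.exp (-(κ * |v|)) =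
      triangleWeight κ (u, v) := by
    rw [triangleWeight, ← Real.exp_add, ← Real.exp_add]
    ring_nf
  simp only [freeKernel, ← e, sub_add_cancel_left, add_sub_cancel_left, add_sub_add_left_eq_sub,
    abs_neg]
  ring

theorem integral_mul_trilinear_sub {w : ℝ × ℝ → ℝ} (hw : Integrable w)
    (hswap : ∀ p, w p.swap = w p) (hneg : ∀ p, w (-p) = w p) (φ q : SchwartzMap ℝ ℝ) :
    (∫ p, w p * trilinear φ q q.lineDeriv p) - (∫ p, w p) * trilinear φ q q.lineDeriv 0 =
      -(1 / 4) * ∫ p, w p * (trilinear φ.lineDeriv q q p + trilinear φ.lineDeriv q q (-p) -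
        2 * trilinear φ.lineDeriv q q 0) := by
  have iA := integrable_mul_trilinear hw φ q q.lineDeriv
  have iA' := integrable_mul_trilinear hw φ q.lineDeriv q
  have iH := integrable_mul_trilinear hw φ.lineDeriv q q
  have sA : ∫ p, w p * trilinear φ q.lineDeriv q p = ∫ p, w p * trilinear φ q q.lineDeriv p := by
    rw [Measure.volume_eq_prod,
      ← integral_prod_swap (fun p => w p * trilinear φ q q.lineDeriv p)]
    simp only [hswap, trilinear_swap]
  have sH : ∫ p, w p * trilinear φ.lineDeriv q q (-p) =
      ∫ p, w p * trilinear φ.lineDeriv q q p := by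
    rw [← integral_neg_eq_self (fun p => w p * trilinear φ.lineDeriv q q p)]
    simp only [hneg]
  have iH' : Integrable fun p => w p * trilinear φ.lineDeriv q q (-p) := by
    simpa only [hneg] using iH.comp_neg
  have hAH : 2 * ∫ p, w p * trilinear φ q q.lineDeriv p =
      -∫ p, w p * trilinear φ.lineDeriv q q p := by
    rw [two_mul]
    nth_rewrite 2 [← sA]
    rw [← integral_add iA iA', ← integral_neg]
    congr 1
    funext p
    rw [← mul_add, ← trilinear_swap φ q q.lineDeriv p, trilinear_add_swap, mul_neg]
  have h0 : 2 * trilinear φ q q.lineDeriv 0 = -trilinear φ.lineDeriv q q 0 := by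
    rw [← trilinear_add_swap, two_mul]
    rfl
  have hS : ∫ p, w p * (trilinear φ.lineDeriv q q p + trilinear φ.lineDeriv q q (-p) -
        2 * trilinear φ.lineDeriv q q 0) = 2 * (∫ p, w p * trilinear φ.lineDeriv q q p) -
        (∫ p, w p) * (2 * trilinear φ.lineDeriv q q 0) := by
    simp only [mul_sub, mul_add]
    rw [integral_sub (iH.fun_add iH') (hw.mul_const _), integral_add iH iH', sH, integral_mul_const]
    ring
  rw [hS]
  linear_combination (1 / 2) * hAH - (1 / 2) * (∫ p, w p) * h0

/-- The quadratic term of the `H_κ` flow converges to the KdV nonlinearity at rate `κ⁻²`: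
`|∫ φ (16κ⁵ T_κ(q,q') − 3qq')| ≤ C κ⁻² ‖φ‖_{H¹} ‖q‖²_{H²}`. -/
theorem quadratic_term_convergence :
    ∃ C > 0, ∀ κ : ℝ, 1 ≤ κ → ∀ q φ : SchwartzMap ℝ ℝ,
      |∫ x : ℝ, φ x * (16 * κ ^ 5 * quadKernel κ (q : ℝ → ℝ) (deriv (q : ℝ → ℝ)) x
          - 3 * q x * deriv (q : ℝ → ℝ) x)|
        ≤ C * κ⁻¹ ^ 2 * H1norm (φ : ℝ → ℝ) * H2norm (q : ℝ → ℝ) ^ 2 := by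
  refine ⟨32, by norm_num, fun κ hκ1 q φ => ?_⟩
  have hκ : 0 < κ := by linarith
  have dq : deriv (q : ℝ → ℝ) = q.lineDeriv := by
    funext x
    exact (derivCLM_apply ℝ q x).symm
  have dφ : deriv (φ : ℝ → ℝ) = φ.lineDeriv := by
    funext x
    exact (derivCLM_apply ℝ φ x).symm
  have ddq : iteratedDeriv 2 (q : ℝ → ℝ) = q.lineDeriv.lineDeriv := by
    funext x
    rw [iteratedDeriv_succ, iteratedDeriv_one, dq, derivCLM_apply]
  set A := H1norm (φ : ℝ → ℝ) with hA
  set B := H2norm (q : ℝ → ℝ) with hB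
  have i0 := q.integrable_sq
  have i1 := q.lineDeriv.integrable_sq
  have i2 := q.lineDeriv.lineDeriv.integrable_sq
  have n0 : 0 ≤ ∫ x, q x ^ 2 := integral_nonneg fun x => sq_nonneg _
  have n1 : 0 ≤ ∫ x, q.lineDeriv x ^ 2 := integral_nonneg fun x => sq_nonneg _
  have n2 : 0 ≤ ∫ x, q.lineDeriv.lineDeriv x ^ 2 := integral_nonneg fun x => sq_nonneg _
  have m0 : 0 ≤ ∫ x, φ x ^ 2 := integral_nonneg fun x => sq_nonneg _
  have m1 : 0 ≤ ∫ x, φ.lineDeriv x ^ 2 := integral_nonneg fun x => sq_nonneg _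
  have hA0 : 0 ≤ A := Real.sqrt_nonneg _
  have hB0 : 0 ≤ B := Real.sqrt_nonneg _
  have hA2 : A ^ 2 = (∫ x, φ x ^ 2) + ∫ x, φ.lineDeriv x ^ 2 := by
    rw [hA, H1norm, dφ, integral_add φ.integrable_sq φ.lineDeriv.integrable_sq,
      Real.sq_sqrt (by positivity)]
  have hB2 : B ^ 2 = (∫ x, q x ^ 2) + (∫ x, q.lineDeriv x ^ 2) +
      ∫ x, q.lineDeriv.lineDeriv x ^ 2 := by
    rw [hB, H2norm, dq, ddq, integral_add (i0.fun_add i1) i2, integral_add i0 i1,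
      Real.sq_sqrt (by positivity)]
  have hs (x : ℝ) : |q x| ≤ B := by
    refine abs_le_of_sq_le_sq ((q.sq_le_integral x).trans ?_) hB0
    rw [integral_add i0 i1, hB2]
    linarith
  have hs' (x : ℝ) : |q.lineDeriv x| ≤ B := by
    refine abs_le_of_sq_le_sq ((q.lineDeriv.sq_le_integral x).trans ?_) hB0
    rw [integral_add i1 i2, hB2]
    linarith
  have hw := integrable_triangleWeight hκ
  have bound := abs_trilinear_second_difference_le (ψ := φ.lineDeriv) hA0 hB0 (by linarith)
    (by linarith) (by linarith) hs hs'
  obtain ⟨iE, vE⟩ := integrable_sq_mul_exp_mul_exp hκ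
  have hsecond : |∫ p, triangleWeight κ p * (trilinear φ.lineDeriv q q p +
      trilinear φ.lineDeriv q q (-p) - 2 * trilinear φ.lineDeriv q q 0)| ≤
      4 * (A * B ^ 2) * (16 / κ ^ 4) := by
    rw [← vE, ← integral_const_mul]
    rw [← Real.norm_eq_abs]
    refine norm_integral_le_of_norm_le (iE.const_mul _) (.of_forall fun p => ?_)
    rw [norm_mul, Real.norm_of_nonneg (triangleWeight_pos κ p).le, Real.norm_eq_abs]
    calc _ ≤ (Real.exp (-(κ * |p.1|)) * Real.exp (-(κ * |p.2|))) *
          (4 * (p.1 ^ 2 + p.2 ^ 2) * (A * B ^ 2)) :=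
          mul_le_mul (triangleWeight_le hκ p) (bound p) (abs_nonneg _) (by positivity)
      _ = _ := by ring
  have hkey := integral_mul_trilinear_sub hw (triangleWeight_swap κ) (triangleWeight_neg κ) φ q
  obtain ⟨iT, vT⟩ := integrable_convolved_and_integral_eq hw φ q q.lineDeriv
  have iQ := integrable_trilinear φ q q.lineDeriv 0 0
  have hmain : ∫ x : ℝ, φ x * (16 * κ ^ 5 * quadKernel κ q q.lineDeriv x -
      3 * q x * q.lineDeriv x) = 2 * κ ^ 2 * ((∫ p, triangleWeight κ p *
      trilinear φ q q.lineDeriv p) - (∫ p, triangleWeight κ p) *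
        trilinear φ q q.lineDeriv 0) := by
    rw [mul_sub, ← vT, integral_triangleWeight hκ, ← integral_const_mul, trilinear]
    simp only [Prod.fst_zero, Prod.snd_zero]
    rw [← mul_assoc, ← integral_const_mul, ← integral_sub (iT.const_mul _) (iQ.const_mul _)]
    congr 1
    funext x
    rw [quadKernel_eq_s6 hκ]
    simp only [add_zero]
    field_simp
    ring
  rw [dq, hmain, hkey, abs_mul, abs_of_pos (by positivity : 0 < 2 * κ ^ 2)]
  rw [abs_mul]
  calc _ ≤ 2 * κ ^ 2 * (|-(1 / 4)| * (4 * (A * B ^ 2) * (16 / κ ^ 4))) := by gcongr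
    _ = _ := by
      rw [abs_neg, abs_of_pos (by norm_num : (0 : ℝ) < 1 / 4)]
      field_simp
      ring
end

section
/- There exists a constant C > 0 such that for every h ∈ ℝ: ∫_ℝ |e^{iξh} − 1|² / (ξ² + 1) dξ ≤ C |h|. -/
theorem norm_exp_I_mul_ofReal_sub_one_sq_le (t : ℝ) :
    ‖Complex.exp (Complex.I * (t : ℂ)) - 1‖ ^ 2 ≤ 5 * t ^ 2 * (1 + t ^ 2)⁻¹ := by
  have h₁ : ‖Complex.exp (Complex.I * (t : ℂ)) - 1‖ ^ 2 ≤ t ^ 2 := by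
    rw [← sq_abs t, ← Real.norm_eq_abs]
    gcongr
    exact Real.norm_exp_I_mul_ofReal_sub_one_le
  have h₂ : ‖Complex.exp (Complex.I * (t : ℂ)) - 1‖ ^ 2 ≤ 4 := by
    rw [Complex.norm_exp_I_mul_ofReal_sub_one, Real.norm_eq_abs, sq_abs]
    nlinarith [Real.sin_sq_le_one (t / 2)]
  rw [← div_eq_mul_inv, le_div_iff₀ (by positivity)]
  nlinarith [mul_le_mul_of_nonneg_right h₂ (sq_nonneg t)]

theorem norm_exp_I_mul_sub_one_sq_div_le (ξ h : ℝ) :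
    ‖Complex.exp (Complex.I * (ξ : ℂ) * (h : ℂ)) - 1‖ ^ 2 / (ξ ^ 2 + 1) ≤
      5 * h ^ 2 * (1 + (h * ξ) ^ 2)⁻¹ := by
  have key := norm_exp_I_mul_ofReal_sub_one_sq_le (h * ξ)
  have hexp : Complex.I * (ξ : ℂ) * (h : ℂ) = Complex.I * ((h * ξ : ℝ) : ℂ) := by
    push_cast
    ring
  rw [hexp, div_le_iff₀ (by positivity)]
  refine key.trans ?_
  have : 0 ≤ 5 * h ^ 2 * (1 + (h * ξ) ^ 2)⁻¹ := by positivity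
  nlinarith

open MeasureTheory

/-- Hölder-`1/2` continuity bound: `∫ |e^{iξh}−1|²/(ξ²+1) dξ ≤ C |h|`. -/
theorem holder_half_bound :
    ∃ C > 0, ∀ h : ℝ,
      (∫ ξ : ℝ, ‖Complex.exp (Complex.I * (ξ : ℂ) * (h : ℂ)) - 1‖ ^ 2 / (ξ ^ 2 + 1)) ≤ C * |h| := by
  refine ⟨5 * Real.pi, by positivity, fun h ↦ ?_⟩
  rcases eq_or_ne h 0 with rfl | hh
  · simp
  calc ∫ ξ : ℝ, ‖Complex.exp (Complex.I * (ξ : ℂ) * (h : ℂ)) - 1‖ ^ 2 / (ξ ^ 2 + 1)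
      ≤ ∫ ξ : ℝ, 5 * h ^ 2 * (1 + (h * ξ) ^ 2)⁻¹ :=
        integral_mono_of_nonneg (.of_forall fun ξ ↦ by positivity)
          ((integrable_inv_one_add_sq.comp_mul_left' hh).const_mul _)
          (.of_forall fun ξ ↦ norm_exp_I_mul_sub_one_sq_div_le ξ h)
    _ = 5 * h ^ 2 * (|h|⁻¹ * Real.pi) := by
        rw [integral_const_mul,
          Measure.integral_comp_mul_left (fun x : ℝ ↦ (1 + x ^ 2)⁻¹) h,
          integral_univ_inv_one_add_sq, abs_inv, smul_eq_mul]
    _ = 5 * Real.pi * |h| := by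
        have : |h| ≠ 0 := abs_ne_zero.mpr hh
        rw [← sq_abs h]
        field_simp
end

section
/- Let T > 0, let V : [−T,T] × ℝ → ℝ be jointly continuous with jointly continuous spatial derivative ∂ₓV, with V and ∂ₓV bounded, and let q be a regular solution on [−T,T] of ∂ₜq = −∂ₓ³q + 6 q ∂ₓq + 6 ∂ₓ(V q). Then the function t ↦ ∫_ℝ q(t,x)² dx is differentiable on [−T,T] and d/dt ∫_ℝ q(t,x)² dx = 6 ∫_ℝ ∂ₓV(t,x) · q(t,x)² dx. -/
open MeasureTheory

/-- `q : [−T,T] × ℝ → ℝ` is a regular solution of KdV with potential `V`,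
`∂ₜq = −∂ₓ³q + 6 q ∂ₓq + 6 ∂ₓ(V q)`: the time derivative exists on the slab, `q`
and its derivatives `∂ₜq, ∂ₓq, ∂ₓ²q, ∂ₓ³q` are jointly continuous on the slab,
`q(t,·)` is Schwartz for each `t` with Schwartz seminorms bounded uniformly in `t`,
and the equation holds pointwise. -/
def IsRegularSolution (T : ℝ) (V q : ℝ → ℝ → ℝ) : Prop :=
  (∀ x : ℝ, ∀ t ∈ Set.Icc (-T) T, DifferentiableAt ℝ (fun s => q s x) t) ∧
  ContinuousOn (fun p : ℝ × ℝ => q p.1 p.2) (Set.Icc (-T) T ×ˢ Set.univ) ∧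
  ContinuousOn (fun p : ℝ × ℝ => deriv (fun s => q s p.2) p.1) (Set.Icc (-T) T ×ˢ Set.univ) ∧
  ContinuousOn (fun p : ℝ × ℝ => deriv (q p.1) p.2) (Set.Icc (-T) T ×ˢ Set.univ) ∧
  ContinuousOn (fun p : ℝ × ℝ => iteratedDeriv 2 (q p.1) p.2) (Set.Icc (-T) T ×ˢ Set.univ) ∧
  ContinuousOn (fun p : ℝ × ℝ => iteratedDeriv 3 (q p.1) p.2) (Set.Icc (-T) T ×ˢ Set.univ) ∧
  (∀ t ∈ Set.Icc (-T) T, ContDiff ℝ (⊤ : ℕ∞) (q t)) ∧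
  (∀ k n : ℕ, ∃ M : ℝ, ∀ t ∈ Set.Icc (-T) T, ∀ x : ℝ,
      |x| ^ k * |iteratedDeriv n (q t) x| ≤ M) ∧
  (∀ t ∈ Set.Icc (-T) T, ∀ x : ℝ,
      deriv (fun s => q s x) t =
        -(iteratedDeriv 3 (q t) x) + 6 * q t x * deriv (q t) x
          + 6 * deriv (fun y => V t y * q t y) x)

/-- Differentiation under the integral sign along a convex set, one-sided at its endpoints. -/
theorem hasDerivWithinAt_integral_of_dominated {α : Type*} [MeasurableSpace α] {μ : Measure α}
    {s : Set ℝ} (hs : Convex ℝ s) {F F' : ℝ → α → ℝ} {bound : α → ℝ}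
    (hF : ∀ t ∈ s, Integrable (F t) μ) (hbound : Integrable bound μ)
    (hderiv : ∀ x, ∀ t ∈ s, HasDerivWithinAt (fun r => F r x) (F' t x) s t)
    (hF' : ∀ x, ∀ t ∈ s, ‖F' t x‖ ≤ bound x) {t : ℝ} (ht : t ∈ s) :
    HasDerivWithinAt (fun r => ∫ x, F r x ∂μ) (∫ x, F' t x ∂μ) s t := by
  rw [hasDerivWithinAt_iff_tendsto_slope]
  have key : Filter.Tendsto (fun r => ∫ x, slope (fun y => F y x) t r ∂μ)
      (nhdsWithin t (s \ {t})) (nhds (∫ x, F' t x ∂μ)) := by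
    refine tendsto_integral_filter_of_dominated_convergence bound ?_ ?_ hbound ?_
    · filter_upwards [self_mem_nhdsWithin] with r hr
      simp only [slope_def_field]
      exact (((hF r hr.1).sub (hF t ht)).div_const _).aestronglyMeasurable
    · filter_upwards [self_mem_nhdsWithin] with r hr
      refine Filter.Eventually.of_forall fun x => ?_
      have h := hs.norm_image_sub_le_of_norm_hasDerivWithin_le (hderiv x) (hF' x) ht hr.1
      rw [slope_def_field, norm_div]
      exact (div_le_iff₀ (norm_pos_iff.2 (sub_ne_zero.2 hr.2))).2 h
    · exact Filter.Eventually.of_forall fun x =>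
        hasDerivWithinAt_iff_tendsto_slope.1 (hderiv x t ht)
  refine key.congr' ?_
  filter_upwards [self_mem_nhdsWithin] with r hr
  simp only [slope_def_field]
  rw [integral_div, integral_sub (hF r hr.1) (hF t ht)]

theorem integrable_of_abs_le_mul_inv_one_add_sq {f : ℝ → ℝ} (hf : Continuous f) {K : ℝ}
    (h : ∀ x, |f x| ≤ K * (1 + x ^ 2)⁻¹) : Integrable f :=
  (integrable_inv_one_add_sq.const_mul K).mono' hf.aestronglyMeasurable
    (Filter.Eventually.of_forall h)

theorem abs_mul_le_mul_of_abs_le {a b A B w : ℝ} (ha : |a| ≤ A * w) (hb : |b| ≤ B) :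
    |a * b| ≤ A * B * w := by
  rw [abs_mul]
  calc |a| * |b| ≤ A * w * B := mul_le_mul ha hb (abs_nonneg _) ((abs_nonneg _).trans ha)
    _ = A * B * w := by ring

/-- The momentum flux of the KdV nonlinearity with potential `v` on a single time slice. -/
theorem integral_two_mul_kdv_eq {u v : ℝ → ℝ} (hu : ContDiff ℝ (⊤ : ℕ∞) u)
    (hv : Differentiable ℝ v) (hv' : Continuous (deriv v)) {B M : ℝ}
    (hB : ∀ n < 4, ∀ x, |iteratedDeriv n u x| ≤ B * (1 + x ^ 2)⁻¹)
    (hB' : ∀ n < 4, ∀ x, |iteratedDeriv n u x| ≤ B)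
    (hM : ∀ x, |v x| ≤ M ∧ |deriv v x| ≤ M) :
    ∫ x, 2 * u x * (-(iteratedDeriv 3 u x) + 6 * u x * deriv u x
      + 6 * deriv (fun y => v y * u y) x) = 6 * ∫ x, deriv v x * u x ^ 2 := by
  have hd : ∀ n x, HasDerivAt (iteratedDeriv n u) (iteratedDeriv (n + 1) u x) x := fun n x => by
    rw [iteratedDeriv_succ]
    exact (hu.differentiable_iteratedDeriv n (by exact_mod_cast WithTop.coe_lt_top _)
      x).hasDerivAt
  have h0 := hd 0
  have h1 := hd 1
  have h2 := hd 2
  have hc : ∀ n, Continuous (iteratedDeriv n u) := fun n =>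
    continuous_iff_continuousAt.2 fun x => (hd n x).continuousAt
  have c0 := hc 0
  have c1 := hc 1
  have c2 := hc 2
  have c3 := hc 3
  have b0 := hB 0 (by norm_num)
  have b1 := hB 1 (by norm_num)
  have b0' := hB' 0 (by norm_num)
  have b1' := hB' 1 (by norm_num)
  have b2' := hB' 2 (by norm_num)
  have b3' := hB' 3 (by norm_num)
  simp only [zero_add, Nat.reduceAdd, iteratedDeriv_zero, iteratedDeriv_one]
    at h0 h1 h2 c0 c1 c2 b0 b1 b0' b1' b2'
  have cv := hv.continuous
  have i0 : ∀ {f : ℝ → ℝ} (_ : Continuous f) (K : ℝ) (_ : ∀ x, |f x| ≤ K),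
      Integrable fun x => u x * f x := fun hf K hK =>
    integrable_of_abs_le_mul_inv_one_add_sq (c0.mul hf)
      fun x => abs_mul_le_mul_of_abs_le (b0 x) (hK x)
  have habs : ∀ {a b A C : ℝ}, |a| ≤ A → |b| ≤ C → |a * b| ≤ A * C := fun ha hb => by
    simpa using abs_mul_le_mul_of_abs_le (w := 1) (by simpa using ha) hb
  have j1 := i0 c3 _ b3'
  have j2 := i0 (c0.mul c1) _ fun x => habs (b0' x) (b1' x)
  have j3 := i0 (hv'.mul c0) _ fun x => habs (hM x).2 (b0' x)
  have j4 := i0 (cv.mul c1) _ fun x => habs (hM x).1 (b1' x)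
  have j5 := i0 c2 _ b2'
  have j6 := i0 (c0.mul c0) _ fun x => habs (b0' x) (b0' x)
  have j7 := i0 (cv.mul c0) _ fun x => habs (hM x).1 (b0' x)
  have j8 : Integrable fun x => deriv u x * deriv u x :=
    integrable_of_abs_le_mul_inv_one_add_sq (c1.mul c1)
      fun x => abs_mul_le_mul_of_abs_le (b1 x) (b1' x)
  have hflux : Integrable fun x => (-2) * (u x * iteratedDeriv 3 u x)
      + 12 * (u x * (u x * deriv u x)) + 6 * (u x * (deriv v x * u x))
      + 12 * (u x * (v x * deriv u x)) :=
    (((j1.const_mul _).add (j2.const_mul _)).add (j3.const_mul _)).add (j4.const_mul _)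
  have hpot : Integrable fun x => 6 * (u x * (deriv v x * u x)) := j3.const_mul _
  have hz := integral_eq_zero_of_hasDerivAt_of_integrable
    (f := fun x => (-2) * (u x * iteratedDeriv 2 u x) + deriv u x * deriv u x
      + 4 * (u x * (u x * u x)) + 6 * (u x * (v x * u x)))
    (f' := fun x => (-2) * (u x * iteratedDeriv 3 u x) + 12 * (u x * (u x * deriv u x))
      + 6 * (u x * (deriv v x * u x)) + 12 * (u x * (v x * deriv u x)))
    (fun x => by
      have hvx := (hv x).hasDerivAt
      refine (((((h0 x).mul (h2 x)).const_mul (-2)).add ((h1 x).mul (h1 x))).add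
        (((h0 x).mul ((h0 x).mul (h0 x))).const_mul 4)).add
        (((h0 x).mul (hvx.mul (h0 x))).const_mul 6) |>.congr_deriv ?_
      simp only [Pi.mul_apply]
      ring)
    hflux
    ((((j5.const_mul _).add j8).add (j6.const_mul _)).add (j7.const_mul _))
  have hsplit : ∀ x, 2 * u x * (-(iteratedDeriv 3 u x) + 6 * u x * deriv u x
      + 6 * deriv (fun y => v y * u y) x) =
      ((-2) * (u x * iteratedDeriv 3 u x) + 12 * (u x * (u x * deriv u x))
      + 6 * (u x * (deriv v x * u x)) + 12 * (u x * (v x * deriv u x)))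
      + 6 * (u x * (deriv v x * u x)) := fun x => by
    have : deriv (fun y => v y * u y) x = _ := ((hv x).hasDerivAt.mul (h0 x)).deriv
    rw [this]
    ring
  simp_rw [hsplit]
  rw [integral_add hflux hpot, hz, zero_add, integral_const_mul]
  congr 2
  ext x
  ring

/-- Momentum growth identity: for a regular solution `q` of KdV with potential `V`,
`d/dt ∫ q² dx = 6 ∫ ∂ₓV q² dx` on `[−T,T]`. -/
theorem momentum_growth (T : ℝ) (hT : 0 < T) (V q : ℝ → ℝ → ℝ)
    (hVc : ContinuousOn (fun p : ℝ × ℝ => V p.1 p.2) (Set.Icc (-T) T ×ˢ Set.univ))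
    (hVx : ∀ t ∈ Set.Icc (-T) T, Differentiable ℝ (V t))
    (hVxc : ContinuousOn (fun p : ℝ × ℝ => deriv (V p.1) p.2) (Set.Icc (-T) T ×ˢ Set.univ))
    (hVbdd : ∃ M : ℝ, ∀ t ∈ Set.Icc (-T) T, ∀ x : ℝ, |V t x| ≤ M ∧ |deriv (V t) x| ≤ M)
    (hq : IsRegularSolution T V q) :
    ∀ t ∈ Set.Icc (-T) T,
      HasDerivWithinAt (fun s => ∫ x : ℝ, q s x ^ 2)
        (6 * ∫ x : ℝ, deriv (V t) x * q t x ^ 2) (Set.Icc (-T) T) t := by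
  obtain ⟨hqt, -, -, -, -, -, hsm, hbd, heq⟩ := hq
  obtain ⟨M, hM⟩ := hVbdd
  have hT0 : (0 : ℝ) ∈ Set.Icc (-T) T := ⟨by linarith, hT.le⟩
  obtain ⟨B, hB⟩ : ∃ B : ℝ, ∀ n < 4, ∀ t ∈ Set.Icc (-T) T, ∀ x,
      (1 + x ^ 2) * |iteratedDeriv n (q t) x| ≤ B := by
    choose C hC using hbd
    refine ⟨∑ n ∈ Finset.range 4, (C 0 n + C 2 n), fun n hn t ht x => ?_⟩
    have hle : ∀ m, ∀ s ∈ Set.Icc (-T) T, ∀ y,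
        (1 + y ^ 2) * |iteratedDeriv m (q s) y| ≤ C 0 m + C 2 m := fun m s hs y => by
      have e0 := hC 0 m s hs y
      have e2 := hC 2 m s hs y
      rw [pow_zero] at e0
      rw [sq_abs] at e2
      linarith
    refine (hle n t ht x).trans (Finset.single_le_sum (f := fun n => C 0 n + C 2 n)
      (fun m _ => ?_) (Finset.mem_range.2 hn))
    exact le_trans (by positivity) (hle m 0 hT0 0)
  have hBw : ∀ t ∈ Set.Icc (-T) T, ∀ n < 4, ∀ x,
      |iteratedDeriv n (q t) x| ≤ B * (1 + x ^ 2)⁻¹ := fun t ht n hn x => by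
    rw [← div_eq_mul_inv, le_div_iff₀ (by positivity), mul_comm]
    exact hB n hn t ht x
  have hB1 : ∀ t ∈ Set.Icc (-T) T, ∀ n < 4, ∀ x,
      |iteratedDeriv n (q t) x| ≤ B := fun t ht n hn x => by
    have h := hB n hn t ht x
    nlinarith [mul_nonneg (sq_nonneg x) (abs_nonneg (iteratedDeriv n (q t) x))]
  have habs : ∀ {a b A C : ℝ}, |a| ≤ A → |b| ≤ C → |a * b| ≤ A * C := fun ha hb => by
    simpa using abs_mul_le_mul_of_abs_le (w := 1) (by simpa using ha) hb
  intro t ht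
  have hmain := hasDerivWithinAt_integral_of_dominated (μ := volume) (convex_Icc (-T) T)
    (F := fun t x => q t x ^ 2)
    (F' := fun t x => 2 * q t x * (-(iteratedDeriv 3 (q t) x) + 6 * q t x * deriv (q t) x
      + 6 * deriv (fun y => V t y * q t y) x))
    (bound := fun x => B * (2 * (B + 6 * (B * B) + 6 * (M * B + M * B))) * (1 + x ^ 2)⁻¹)
    (fun s hs => ?_) (integrable_inv_one_add_sq.const_mul _) (fun x s hs => ?_)
    (fun x s hs => ?_) ht
  · have hVt : Continuous (deriv (V t)) :=
      continuousOn_univ.1 (hVxc.comp (f := fun x : ℝ => (t, x)) (by fun_prop)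
        fun x _ => ⟨ht, Set.mem_univ x⟩)
    rwa [integral_two_mul_kdv_eq (hsm t ht) (hVx t ht) hVt (hBw t ht) (hB1 t ht) (hM t ht)]
      at hmain
  · have b0 := hBw s hs 0 (by norm_num)
    have b0' := hB1 s hs 0 (by norm_num)
    rw [iteratedDeriv_zero] at b0 b0'
    refine integrable_of_abs_le_mul_inv_one_add_sq ((hsm s hs).continuous.pow 2)
      (K := B * B) fun x => ?_
    rw [pow_two]
    exact abs_mul_le_mul_of_abs_le (b0 x) (b0' x)
  · have h := (hqt x s hs).hasDerivAt
    rw [heq s hs x] at h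
    refine ((h.pow 2).congr_deriv ?_).hasDerivWithinAt
    norm_num
  · have b0 := hBw s hs 0 (by norm_num) x
    have b0' := hB1 s hs 0 (by norm_num) x
    have b1' := hB1 s hs 1 (by norm_num) x
    have b3' := hB1 s hs 3 (by norm_num) x
    rw [iteratedDeriv_zero] at b0 b0'
    rw [iteratedDeriv_one] at b1'
    have hq1 : DifferentiableAt ℝ (q s) x := (hsm s hs).differentiable (by simp) x
    have hVq : deriv (fun y => V s y * q s y) x = _ :=
      ((hVx s hs x).hasDerivAt.mul hq1.hasDerivAt).deriv
    rw [hVq, Real.norm_eq_abs, mul_comm (2 : ℝ), mul_assoc (q s x)]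
    refine abs_mul_le_mul_of_abs_le b0 ?_
    have e1 := abs_le.1 b3'
    have e2 := abs_le.1 (habs b0' b1')
    have e3 := abs_le.1 (habs (hM s hs x).2 b0')
    have e4 := abs_le.1 (habs (hM s hs x).1 b1')
    rw [abs_le]
    constructor <;> linarith [e1.1, e1.2, e2.1, e2.2, e3.1, e3.2, e4.1, e4.2]
end

section
/- Let T > 0, let V : [−T,T] × ℝ → ℝ be jointly continuous with jointly continuous spatial derivative ∂ₓV, with V and ∂ₓV bounded, and let q and q̃ both be regular solutions on [−T,T] of ∂ₜq = −∂ₓ³q + 6 q ∂ₓq + 6 ∂ₓ(V q) with the same potential V. If q(0,x) = q̃(0,x) for all x ∈ ℝ, then q(t,x) = q̃(t,x) for all t ∈ [−T,T] and all x ∈ ℝ. -/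
open MeasureTheory

lemma abs_iteratedDeriv_sub_le_inv_one_add_sq {T : ℝ} {V q qt : ℝ → ℝ → ℝ}
    (hq : IsRegularSolution T V q) (hqt : IsRegularSolution T V qt) (n : ℕ) :
    ∃ C : ℝ, ∀ t ∈ Set.Icc (-T) T, ∀ x : ℝ,
      |iteratedDeriv n (q t) x - iteratedDeriv n (qt t) x| ≤ C * (1 + x ^ 2)⁻¹ := by
  obtain ⟨-, -, -, -, -, -, -, hs, -⟩ := hq
  obtain ⟨-, -, -, -, -, -, -, hst, -⟩ := hqt
  obtain ⟨A, hA⟩ := hs 0 n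
  obtain ⟨B, hB⟩ := hs 2 n
  obtain ⟨A', hA'⟩ := hst 0 n
  obtain ⟨B', hB'⟩ := hst 2 n
  refine ⟨A + B + A' + B', fun t ht x => ?_⟩
  have hx : 0 < 1 + x ^ 2 := by positivity
  rw [← div_eq_mul_inv, le_div_iff₀ hx]
  have h1 := hA t ht x
  have h2 := hB t ht x
  have h3 := hA' t ht x
  have h4 := hB' t ht x
  rw [sq_abs] at h2 h4
  have h5 := mul_le_mul_of_nonneg_right
    (abs_sub (iteratedDeriv n (q t) x) (iteratedDeriv n (qt t) x)) hx.le
  simp only [pow_zero, one_mul] at h1 h3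
  linarith

lemma hasDerivAt_iteratedDeriv {f : ℝ → ℝ} (hf : ContDiff ℝ (⊤ : ℕ∞) f) (n : ℕ) (x : ℝ) :
    HasDerivAt (iteratedDeriv n f) (iteratedDeriv (n + 1) f x) x := by
  rw [iteratedDeriv_succ]
  exact ((hf.differentiable_iteratedDeriv n (by exact_mod_cast WithTop.coe_lt_top n)) x).hasDerivAt

lemma Continuous.integrable_of_abs_le_inv_one_add_sq {f : ℝ → ℝ} {C : ℝ} (hf : Continuous f)
    (h : ∀ x, |f x| ≤ C * (1 + x ^ 2)⁻¹) : Integrable f :=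
  (integrable_inv_one_add_sq.const_mul C).mono' hf.aestronglyMeasurable
    (Filter.Eventually.of_forall h)

lemma inv_one_add_sq_le_one (x : ℝ) : (1 + x ^ 2)⁻¹ ≤ 1 :=
  inv_le_one_of_one_le₀ (by nlinarith [sq_nonneg x])

lemma integrable_sq_of_abs_le_inv_one_add_sq {f : ℝ → ℝ} {C : ℝ} (hf : Continuous f)
    (hC : 0 ≤ C) (h : ∀ x, |f x| ≤ C * (1 + x ^ 2)⁻¹) : Integrable fun x => f x ^ 2 := by
  have hf2 : Continuous fun x => f x ^ 2 := hf.pow 2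
  refine hf2.integrable_of_abs_le_inv_one_add_sq (C := C * C) fun x => ?_
  have hr : C * (1 + x ^ 2)⁻¹ ≤ C := mul_le_of_le_one_right hC (inv_one_add_sq_le_one x)
  rw [abs_pow, pow_two]
  calc |f x| * |f x| ≤ C * (C * (1 + x ^ 2)⁻¹) := by
        gcongr; exacts [(h x).trans hr, h x]
    _ = _ := by ring

/-- The spatial part of the energy estimate for `∂ₜw = -∂ₓ³w + ∂ₓ(b w)`. -/
lemma integral_two_mul_mul_linearized_kdv {w w1 w2 w3 b b1 : ℝ → ℝ} {C : ℝ} (hC : 0 ≤ C)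
    (hw : ∀ x, HasDerivAt w (w1 x) x) (hw1 : ∀ x, HasDerivAt w1 (w2 x) x)
    (hw2 : ∀ x, HasDerivAt w2 (w3 x) x) (hb : ∀ x, HasDerivAt b (b1 x) x)
    (hwC : ∀ x, |w x| ≤ C * (1 + x ^ 2)⁻¹) (hw1C : ∀ x, |w1 x| ≤ C * (1 + x ^ 2)⁻¹)
    (hw2C : ∀ x, |w2 x| ≤ C) (hbC : ∀ x, |b x| ≤ C)
    (hint : Integrable fun x => 2 * w x * (-w3 x + (b1 x * w x + b x * w1 x)))
    (hint' : Integrable fun x => b1 x * w x ^ 2) :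
    ∫ x, 2 * w x * (-w3 x + (b1 x * w x + b x * w1 x)) = ∫ x, b1 x * w x ^ 2 := by
  have hder : ∀ x, HasDerivAt (fun x => -2 * (w x * w2 x) + w1 x ^ 2 + b x * w x ^ 2)
      (2 * w x * (-w3 x + (b1 x * w x + b x * w1 x)) - b1 x * w x ^ 2) x := fun x => by
    have h := ((((hw x).mul (hw2 x)).const_mul (-2)).add ((hw1 x).pow 2)).add
      ((hb x).mul ((hw x).pow 2))
    refine h.congr_deriv ?_
    simp only [Pi.pow_apply, Nat.cast_ofNat, Nat.add_one_sub_one, pow_one]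
    ring
  have hbound : ∀ x, ‖-2 * (w x * w2 x) + w1 x ^ 2 + b x * w x ^ 2‖ ≤
      (3 * C ^ 2 + C ^ 3) * (1 + x ^ 2)⁻¹ := fun x => by
    set r := (1 + x ^ 2)⁻¹ with hr
    have hr0 : 0 ≤ r := by positivity
    have hr1 : C * r ≤ C := mul_le_of_le_one_right hC (inv_one_add_sq_le_one x)
    have e1 : |w x| * |w2 x| ≤ C * r * C := by gcongr; exacts [hwC x, hw2C x]
    have e2 : |w1 x| * |w1 x| ≤ C * r * C := by
      gcongr; exacts [hw1C x, (hw1C x).trans hr1]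
    have e3 : |b x| * (|w x| * |w x|) ≤ C * (C * r * C) := by
      gcongr; exacts [hbC x, hwC x, (hwC x).trans hr1]
    have := abs_add_three (-2 * (w x * w2 x)) (w1 x ^ 2) (b x * w x ^ 2)
    simp only [abs_mul, abs_neg, pow_two, Nat.abs_ofNat] at this
    rw [Real.norm_eq_abs]
    simp only [pow_two]
    linarith
  have hlim : Filter.Tendsto (fun x : ℝ => (3 * C ^ 2 + C ^ 3) * (1 + x ^ 2)⁻¹)
      (Filter.cocompact ℝ) (nhds 0) := by
    rw [← mul_zero (3 * C ^ 2 + C ^ 3)]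
    refine Filter.Tendsto.const_mul _ (Filter.Tendsto.inv_tendsto_atTop ?_)
    refine Filter.tendsto_atTop_add_const_left _ _ ?_
    have := (Filter.tendsto_pow_atTop (two_ne_zero)).comp (tendsto_norm_cocompact_atTop (E := ℝ))
    simpa [Function.comp_def] using this
  have hG := squeeze_zero_norm hbound hlim
  have h := integral_of_hasDerivAt_of_tendsto hder (hint.sub hint')
    (hG.mono_left atBot_le_cocompact) (hG.mono_left atTop_le_cocompact)
  rw [integral_sub hint hint'] at h
  linarith

lemma hasDerivAt_integral_sq {a b C D : ℝ} {w wt : ℝ → ℝ → ℝ}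
    (hw : ∀ t ∈ Set.Ioo a b, ∀ x, HasDerivAt (fun s => w s x) (wt t x) t)
    (hwc : ∀ t ∈ Set.Ioo a b, Continuous (w t)) (hwtc : ∀ t ∈ Set.Ioo a b, Continuous (wt t))
    (hwC : ∀ t ∈ Set.Ioo a b, ∀ x, |w t x| ≤ C * (1 + x ^ 2)⁻¹)
    (hwtD : ∀ t ∈ Set.Ioo a b, ∀ x, |wt t x| ≤ D) (hC : 0 ≤ C) {t : ℝ} (ht : t ∈ Set.Ioo a b) :
    Integrable (fun x => 2 * w t x * wt t x) ∧
      HasDerivAt (fun s => ∫ x, w s x ^ 2) (∫ x, 2 * w t x * wt t x) t := by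
  have hnhds : Set.Ioo a b ∈ nhds t := isOpen_Ioo.mem_nhds ht
  refine hasDerivAt_integral_of_dominated_loc_of_deriv_le (s := Set.Ioo a b)
    (F := fun s x => w s x ^ 2) (F' := fun s x => 2 * w s x * wt s x)
    (bound := fun x => 2 * C * D * (1 + x ^ 2)⁻¹) hnhds ?_ ?_ ?_ ?_ ?_ ?_
  · filter_upwards [hnhds] with s hs
    exact ((hwc s hs).pow 2).aestronglyMeasurable
  · exact integrable_sq_of_abs_le_inv_one_add_sq (hwc t ht) hC (hwC t ht)
  · exact ((continuous_const.mul (hwc t ht)).mul (hwtc t ht)).aestronglyMeasurable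
  · refine Filter.Eventually.of_forall fun x s hs => ?_
    rw [Real.norm_eq_abs, abs_mul, abs_mul, Nat.abs_ofNat]
    calc 2 * |w s x| * |wt s x| ≤ 2 * (C * (1 + x ^ 2)⁻¹) * D := by
          gcongr; exacts [hwC s hs x, hwtD s hs x]
      _ = _ := by ring
  · exact integrable_inv_one_add_sq.const_mul _
  · refine Filter.Eventually.of_forall fun x s hs => ?_
    exact ((hw s hs x).pow 2).congr_deriv (by simp)

/-- Two-sided Grönwall inequality with zero data. -/
lemma eq_zero_of_abs_deriv_le_mul_abs_self {T K : ℝ} {E E' : ℝ → ℝ}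
    (hE : ∀ t ∈ Set.Ioo (-T) T, HasDerivAt E (E' t) t)
    (hK : ∀ t ∈ Set.Ioo (-T) T, |E' t| ≤ K * |E t|) (h0 : E 0 = 0) :
    ∀ t ∈ Set.Ioo (-T) T, E t = 0 := by
  intro t ht
  rcases le_total 0 t with h | h
  · have hmem : ∀ s ∈ Set.Icc 0 t, s ∈ Set.Ioo (-T) T := fun s hs =>
      ⟨by linarith [hs.1, ht.2], by linarith [hs.2, ht.2]⟩
    exact eq_zero_of_abs_deriv_le_mul_abs_self_of_eq_zero_right (a := 0) (b := t) (K := K)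
      (fun s hs => (hE s (hmem s hs)).continuousAt.continuousWithinAt)
      (fun s hs => (hE s (hmem s (Set.Ico_subset_Icc_self hs))).hasDerivWithinAt) h0
      (fun s hs => hK s (hmem s (Set.Ico_subset_Icc_self hs))) t ⟨h, le_rfl⟩
  · have hmem : ∀ s ∈ Set.Icc 0 (-t), -s ∈ Set.Ioo (-T) T := fun s hs =>
      ⟨by linarith [hs.2, ht.1], by linarith [hs.1, ht.1]⟩
    have hd : ∀ s ∈ Set.Icc 0 (-t), HasDerivAt (fun s => E (-s)) (-E' (-s)) s := fun s hs => by
      simpa [Function.comp_def] using (hE (-s) (hmem s hs)).comp s (hasDerivAt_neg s)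
    have := eq_zero_of_abs_deriv_le_mul_abs_self_of_eq_zero_right (a := 0) (b := -t) (K := K)
      (f := fun s => E (-s)) (f' := fun s => -E' (-s))
      (fun s hs => (hd s hs).continuousAt.continuousWithinAt)
      (fun s hs => (hd s (Set.Ico_subset_Icc_self hs)).hasDerivWithinAt) (by simpa using h0)
      (fun s hs => by simpa using hK (-s) (hmem s (Set.Ico_subset_Icc_self hs)))
      (-t) ⟨by linarith, le_rfl⟩
    simpa using this

lemma ContinuousOn.continuous_slice {S : Set ℝ} {f : ℝ × ℝ → ℝ}
    (hf : ContinuousOn f (S ×ˢ Set.univ)) {t : ℝ} (ht : t ∈ S) : Continuous fun x => f (t, x) :=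
  hf.comp_continuous (by fun_prop) fun _ => ⟨ht, trivial⟩

/-- Uniqueness of regular solutions to KdV with potential `V`: two regular solutions
with the same initial data coincide on `[−T,T] × ℝ`. -/
theorem uniqueness_regular_solutions (T : ℝ) (hT : 0 < T) (V q qt : ℝ → ℝ → ℝ)
    (hVc : ContinuousOn (fun p : ℝ × ℝ => V p.1 p.2) (Set.Icc (-T) T ×ˢ Set.univ))
    (hVx : ∀ t ∈ Set.Icc (-T) T, Differentiable ℝ (V t))
    (hVxc : ContinuousOn (fun p : ℝ × ℝ => deriv (V p.1) p.2) (Set.Icc (-T) T ×ˢ Set.univ))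
    (hVbdd : ∃ M : ℝ, ∀ t ∈ Set.Icc (-T) T, ∀ x : ℝ, |V t x| ≤ M ∧ |deriv (V t) x| ≤ M)
    (hq : IsRegularSolution T V q) (hqt : IsRegularSolution T V qt)
    (h0 : ∀ x : ℝ, q 0 x = qt 0 x) :
    ∀ t ∈ Set.Icc (-T) T, ∀ x : ℝ, q t x = qt t x := by
  obtain ⟨M, hM⟩ := hVbdd
  obtain ⟨C0, hC0⟩ := abs_iteratedDeriv_sub_le_inv_one_add_sq hq hqt 0
  obtain ⟨C1, hC1⟩ := abs_iteratedDeriv_sub_le_inv_one_add_sq hq hqt 1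
  obtain ⟨C2, hC2⟩ := abs_iteratedDeriv_sub_le_inv_one_add_sq hq hqt 2
  obtain ⟨C3, hC3⟩ := abs_iteratedDeriv_sub_le_inv_one_add_sq hq hqt 3
  obtain ⟨hd, hc, htc, -, -, -, hs, hb, heq⟩ := hq
  obtain ⟨hd', hc', htc', -, -, -, hs', hb', heq'⟩ := hqt
  obtain ⟨A0, hA0⟩ := hb 0 0
  obtain ⟨A1, hA1⟩ := hb 0 1
  obtain ⟨B0, hB0⟩ := hb' 0 0
  obtain ⟨B1, hB1⟩ := hb' 0 1
  simp only [pow_zero, one_mul, iteratedDeriv_zero, iteratedDeriv_one] at hA0 hA1 hB0 hB1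
  simp only [iteratedDeriv_zero] at hC0
  simp only [iteratedDeriv_one] at hC1
  set b : ℝ → ℝ → ℝ := fun t x => 3 * (q t x + qt t x) + 6 * V t x with hbdef
  set b1 : ℝ → ℝ → ℝ := fun t x =>
    3 * (deriv (q t) x + deriv (qt t) x) + 6 * deriv (V t) x with hb1def
  set w : ℝ → ℝ → ℝ := fun t x => q t x - qt t x with hwdef
  set w1 : ℝ → ℝ → ℝ := fun t x => deriv (q t) x - deriv (qt t) x with hw1def
  set w2 : ℝ → ℝ → ℝ := fun t x => iteratedDeriv 2 (q t) x - iteratedDeriv 2 (qt t) x with hw2def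
  set w3 : ℝ → ℝ → ℝ := fun t x => iteratedDeriv 3 (q t) x - iteratedDeriv 3 (qt t) x with hw3def
  obtain ⟨C, hC⟩ : ∃ C, C = |C0| + |C1| + |C2| + |C3| + 3 * (|A0| + |B0|) + 3 * (|A1| + |B1|)
    + 6 * |M| := ⟨_, rfl⟩
  have hCnn : 0 ≤ C := by rw [hC]; positivity
  have hbC : ∀ t ∈ Set.Icc (-T) T, ∀ x, |b t x| ≤ C := fun t ht x => by
    have h1 := abs_le.1 ((hA0 t ht x).trans (le_abs_self A0))
    have h2 := abs_le.1 ((hB0 t ht x).trans (le_abs_self B0))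
    have h3 := abs_le.1 ((hM t ht x).1.trans (le_abs_self M))
    have : 0 ≤ |C0| + |C1| + |C2| + |C3| + 3 * (|A1| + |B1|) := by positivity
    rw [abs_le]; constructor <;> simp only [hbdef] <;> linarith
  have hb1C : ∀ t ∈ Set.Icc (-T) T, ∀ x, |b1 t x| ≤ C := fun t ht x => by
    have h1 := abs_le.1 ((hA1 t ht x).trans (le_abs_self A1))
    have h2 := abs_le.1 ((hB1 t ht x).trans (le_abs_self B1))
    have h3 := abs_le.1 ((hM t ht x).2.trans (le_abs_self M))
    have : 0 ≤ |C0| + |C1| + |C2| + |C3| + 3 * (|A0| + |B0|) := by positivity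
    rw [abs_le]; constructor <;> simp only [hb1def] <;> linarith
  have hle : ∀ (c x : ℝ), c ≤ C → c * (1 + x ^ 2)⁻¹ ≤ C * (1 + x ^ 2)⁻¹ := fun c x h => by
    gcongr
  have hp : 0 ≤ 3 * (|A0| + |B0|) + 3 * (|A1| + |B1|) + 6 * |M| := by positivity
  have n0 := abs_nonneg C0
  have n1 := abs_nonneg C1
  have n2 := abs_nonneg C2
  have n3 := abs_nonneg C3
  have hwC : ∀ t ∈ Set.Icc (-T) T, ∀ x, |w t x| ≤ C * (1 + x ^ 2)⁻¹ := fun t ht x =>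
    (hC0 t ht x).trans (hle _ _ (by linarith [le_abs_self C0]))
  have hw1C : ∀ t ∈ Set.Icc (-T) T, ∀ x, |w1 t x| ≤ C * (1 + x ^ 2)⁻¹ := fun t ht x =>
    (hC1 t ht x).trans (hle _ _ (by linarith [le_abs_self C1]))
  have hw2C : ∀ t ∈ Set.Icc (-T) T, ∀ x, |w2 t x| ≤ C * (1 + x ^ 2)⁻¹ := fun t ht x =>
    (hC2 t ht x).trans (hle _ _ (by linarith [le_abs_self C2]))
  have hw3C : ∀ t ∈ Set.Icc (-T) T, ∀ x, |w3 t x| ≤ C * (1 + x ^ 2)⁻¹ := fun t ht x =>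
    (hC3 t ht x).trans (hle _ _ (by linarith [le_abs_self C3]))
  have hr : ∀ x : ℝ, C * (1 + x ^ 2)⁻¹ ≤ C := fun x =>
    mul_le_of_le_one_right hCnn (inv_one_add_sq_le_one x)
  have hqd : ∀ t ∈ Set.Icc (-T) T, ∀ x, HasDerivAt (q t) (deriv (q t) x) x := fun t ht x => by
    simpa using hasDerivAt_iteratedDeriv (hs t ht) 0 x
  have hqd' : ∀ t ∈ Set.Icc (-T) T, ∀ x, HasDerivAt (qt t) (deriv (qt t) x) x := fun t ht x => by
    simpa using hasDerivAt_iteratedDeriv (hs' t ht) 0 x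
  have hVd : ∀ t ∈ Set.Icc (-T) T, ∀ x, HasDerivAt (V t) (deriv (V t) x) x := fun t ht x =>
    (hVx t ht x).hasDerivAt
  have hwd : ∀ t ∈ Set.Icc (-T) T, ∀ x, HasDerivAt (w t) (w1 t x) x := fun t ht x =>
    (hqd t ht x).sub (hqd' t ht x)
  have hw1d : ∀ t ∈ Set.Icc (-T) T, ∀ x, HasDerivAt (w1 t) (w2 t x) x := fun t ht x => by
    have h1 := hasDerivAt_iteratedDeriv (hs t ht) 1 x
    have h2 := hasDerivAt_iteratedDeriv (hs' t ht) 1 x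
    rw [iteratedDeriv_one] at h1 h2
    exact h1.sub h2
  have hw2d : ∀ t ∈ Set.Icc (-T) T, ∀ x, HasDerivAt (w2 t) (w3 t x) x := fun t ht x =>
    (hasDerivAt_iteratedDeriv (hs t ht) 2 x).sub (hasDerivAt_iteratedDeriv (hs' t ht) 2 x)
  have hbd : ∀ t ∈ Set.Icc (-T) T, ∀ x, HasDerivAt (b t) (b1 t x) x := fun t ht x =>
    (((hqd t ht x).add (hqd' t ht x)).const_mul 3).add ((hVd t ht x).const_mul 6)
  have hb1c : ∀ t ∈ Set.Icc (-T) T, Continuous (b1 t) := fun t ht => by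
    have h1 := (hs t ht).continuous_iteratedDeriv 1 (by exact_mod_cast le_top)
    have h2 := (hs' t ht).continuous_iteratedDeriv 1 (by exact_mod_cast le_top)
    have h3 := hVxc.continuous_slice ht
    rw [iteratedDeriv_one] at h1 h2
    simp only [hb1def]
    fun_prop
  have hwc : ∀ t ∈ Set.Icc (-T) T, Continuous (w t) := fun t ht =>
    (hs t ht).continuous.sub (hs' t ht).continuous
  set wt : ℝ → ℝ → ℝ := fun t x => deriv (fun s => q s x) t - deriv (fun s => qt s x) t with hwtdef
  have hwtd : ∀ t ∈ Set.Icc (-T) T, ∀ x, HasDerivAt (fun s => w s x) (wt t x) t := fun t ht x =>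
    (hd x t ht).hasDerivAt.sub (hd' x t ht).hasDerivAt
  have hwtc : ∀ t ∈ Set.Icc (-T) T, Continuous (wt t) := fun t ht =>
    (htc.continuous_slice ht).sub (htc'.continuous_slice ht)
  have hwteq : ∀ t ∈ Set.Icc (-T) T, ∀ x,
      wt t x = -w3 t x + (b1 t x * w t x + b t x * w1 t x) := fun t ht x => by
    have e1 : deriv (fun y => V t y * q t y) x = _ := ((hVd t ht x).mul (hqd t ht x)).deriv
    have e2 : deriv (fun y => V t y * qt t y) x = _ := ((hVd t ht x).mul (hqd' t ht x)).deriv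
    simp only [hwtdef, heq t ht x, heq' t ht x, e1, e2, hb1def, hbdef, hwdef, hw1def, hw3def]
    ring
  have hwtD : ∀ t ∈ Set.Icc (-T) T, ∀ x, |wt t x| ≤ C + (C * C + C * C) := fun t ht x => by
    rw [hwteq t ht x]
    refine (abs_add_le _ _).trans (add_le_add ?_ ((abs_add_le _ _).trans (add_le_add ?_ ?_)))
    · rw [abs_neg]; exact (hw3C t ht x).trans (hr x)
    · rw [abs_mul]; gcongr; exacts [hb1C t ht x, (hwC t ht x).trans (hr x)]
    · rw [abs_mul]; gcongr; exacts [hbC t ht x, (hw1C t ht x).trans (hr x)]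
  have hsub : ∀ t ∈ Set.Ioo (-T) T, t ∈ Set.Icc (-T) T := fun t ht => Set.Ioo_subset_Icc_self ht
  have hE : ∀ t ∈ Set.Ioo (-T) T, _ := fun t ht =>
    hasDerivAt_integral_sq (fun t ht => hwtd t (hsub t ht)) (fun t ht => hwc t (hsub t ht))
      (fun t ht => hwtc t (hsub t ht)) (fun t ht => hwC t (hsub t ht))
      (fun t ht => hwtD t (hsub t ht)) hCnn ht
  have hsqint : ∀ t ∈ Set.Icc (-T) T, Integrable fun x => w t x ^ 2 := fun t ht =>
    integrable_sq_of_abs_le_inv_one_add_sq (hwc t ht) hCnn (hwC t ht)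
  have hK : ∀ t ∈ Set.Ioo (-T) T,
      |∫ x, 2 * w t x * wt t x| ≤ C * |∫ x, w t x ^ 2| := fun t ht' => by
    have ht := hsub t ht'
    have hint := (hE t ht').1
    have hnn : 0 ≤ ∫ x, w t x ^ 2 := integral_nonneg fun x => sq_nonneg (w t x)
    have hint' : Integrable fun x => b1 t x * w t x ^ 2 :=
      (hsqint t ht).bdd_mul (hb1c t ht).aestronglyMeasurable
        (Filter.Eventually.of_forall (hb1C t ht))
    simp only [hwteq t ht] at hint ⊢
    rw [integral_two_mul_mul_linearized_kdv hCnn (hwd t ht) (hw1d t ht) (hw2d t ht) (hbd t ht)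
      (hwC t ht) (hw1C t ht) (fun x => (hw2C t ht x).trans (hr x)) (hbC t ht) hint hint',
      abs_of_nonneg hnn, ← integral_const_mul, ← Real.norm_eq_abs]
    refine norm_integral_le_of_norm_le ((hsqint t ht).const_mul C)
      (Filter.Eventually.of_forall fun x => ?_)
    rw [norm_mul, Real.norm_of_nonneg (sq_nonneg (w t x))]
    gcongr
    exact hb1C t ht x
  have hzero := eq_zero_of_abs_deriv_le_mul_abs_self (fun t ht => (hE t ht).2) hK
    (by simp [hwdef, h0])
  have hint0 : ∀ t ∈ Set.Ioo (-T) T, ∀ x, q t x = qt t x := fun t ht x => by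
    have h := (integral_eq_zero_iff_of_nonneg (fun x => sq_nonneg (w t x))
      (hsqint t (hsub t ht))).1 (hzero t ht)
    have h2 := congrFun ((Continuous.ae_eq_iff_eq volume ((hwc t (hsub t ht)).pow 2)
      continuous_const).1 h) x
    have h3 : w t x = 0 := pow_eq_zero_iff two_ne_zero |>.1 h2
    exact sub_eq_zero.1 h3
  intro t ht x
  have hcx : ∀ {f : ℝ → ℝ → ℝ}, ContinuousOn (fun p : ℝ × ℝ => f p.1 p.2)
      (Set.Icc (-T) T ×ˢ Set.univ) → ContinuousOn (fun s => f s x) (Set.Icc (-T) T) := fun h =>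
    h.comp (f := fun s => (s, x)) (by fun_prop) fun s hs => ⟨hs, trivial⟩
  refine Set.EqOn.of_subset_closure (s := Set.Ioo (-T) T) (fun s hs => hint0 s hs x)
    (hcx hc) (hcx hc') Set.Ioo_subset_Icc_self ?_ ht
  rw [closure_Ioo (by linarith)]
end
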